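/- Let α>1 and 0<β<∞, let u be holomorphic on 𝔻 and φ a holomorphic self-map of 𝔻, and suppose uC_φ maps B^α boundedly into Z_β. Then there exist constants c, C > 0 depending only on α and β (not on u and φ) such that c·M ≤ ‖uC_φ‖_e ≤ C·M, where ‖uC_φ‖_e is the essential norm of uC_φ : B^α → Z_β and M = max{ limsup_{|φ(z)|→1} (1-|z|²)^β |u''(z)| / (1-|φ(z)|²)^{α-1}, limsup_{|φ(z)|→1} (1-|z|²)^β |2u'(z)φ'(z) + u(z)φ''(z)| / (1-|φ(z)|²)^α, limsup_{|φ(z)|→1} (1-|z|²)^β |u(z)| |φ'(z)|² / (1-|φ(z)|²)^{α+1} }. -/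

import Mathlib

open Complex Filter Set

noncomputable section

/-- The open unit disk in `ℂ`. -/
def unitDisk : Set ℂ := Metric.ball 0 1

/-- The weighted sup-norm `‖g‖_{ν_γ} = sup_{z ∈ 𝔻} (1-|z|²)^γ |g(z)|`. -/
def wnorm (γ : ℝ) (g : ℂ → ℂ) : ℝ :=
  sSup ((fun z => (1 - ‖z‖ ^ 2) ^ γ * ‖g z‖) '' unitDisk)

/-- Membership in the weighted Banach space `H^∞_{ν_β}`. -/
def MemWeighted (β : ℝ) (g : ℂ → ℂ) : Prop :=
  DifferentiableOn ℂ g unitDisk ∧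
    BddAbove ((fun z => (1 - ‖z‖ ^ 2) ^ β * ‖g z‖) '' unitDisk)

/-- Membership in the Bloch type space `B^α`. -/
def MemBloch (α : ℝ) (f : ℂ → ℂ) : Prop :=
  DifferentiableOn ℂ f unitDisk ∧
    BddAbove ((fun z => (1 - ‖z‖ ^ 2) ^ α * ‖deriv f z‖) '' unitDisk)

/-- The Bloch type norm `‖f‖_{B^α} = |f(0)| + sup_{z∈𝔻}(1-|z|²)^α |f'(z)|`. -/
def blochNorm (α : ℝ) (f : ℂ → ℂ) : ℝ :=
  ‖f 0‖ + wnorm α (deriv f)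

/-- Membership in the Zygmund type space `Z_β`. -/
def MemZygmund (β : ℝ) (f : ℂ → ℂ) : Prop :=
  DifferentiableOn ℂ f unitDisk ∧
    BddAbove ((fun z => (1 - ‖z‖ ^ 2) ^ β * ‖deriv (deriv f) z‖) '' unitDisk)

/-- The Zygmund type norm `‖f‖_{Z_β} = |f(0)| + |f'(0)| + sup_{z∈𝔻}(1-|z|²)^β |f''(z)|`. -/
def zygNorm (β : ℝ) (f : ℂ → ℂ) : ℝ :=
  ‖f 0‖ + ‖deriv f 0‖ + wnorm β (deriv (deriv f))

/-- The weighted composition operator `uC_φ f = u · (f ∘ φ)`. -/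
def wcomp (u φ f : ℂ → ℂ) : ℂ → ℂ := fun z => u z * f (φ z)

/-- `uC_φ` maps `B^α` boundedly into `Z_β`. -/
def BoundedBlochToZygmund (α β : ℝ) (u φ : ℂ → ℂ) : Prop :=
  (∀ f, MemBloch α f → MemZygmund β (wcomp u φ f)) ∧
    ∃ C > 0, ∀ f, MemBloch α f → zygNorm β (wcomp u φ f) ≤ C * blochNorm α f

/-- `uC_φ` maps `B^α` boundedly into `H^∞_{ν_β}`. -/
def BoundedBlochToWeighted (α β : ℝ) (u φ : ℂ → ℂ) : Prop :=
  (∀ f, MemBloch α f → MemWeighted β (wcomp u φ f)) ∧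
    ∃ C > 0, ∀ f, MemBloch α f → wnorm β (wcomp u φ f) ≤ C * blochNorm α f

/-- `uC_φ : B^α → Z_β` is compact: it is bounded and maps bounded sets of `B^α` to
totally bounded (equivalently, since `Z_β` is complete, relatively compact) subsets
of `Z_β`. -/
def CompactBlochToZygmund (α β : ℝ) (u φ : ℂ → ℂ) : Prop :=
  BoundedBlochToZygmund α β u φ ∧
    ∀ r : ℝ, ∀ ε : ℝ, 0 < ε → ∃ T : Finset (ℂ → ℂ),
      (∀ g ∈ T, MemZygmund β g) ∧
      ∀ f, MemBloch α f → blochNorm α f ≤ r →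
        ∃ g ∈ T, zygNorm β (fun z => wcomp u φ f z - g z) ≤ ε

/-- `uC_φ : B^α → H^∞_{ν_β}` is compact: it is bounded and maps bounded sets of `B^α`
to totally bounded (equivalently, relatively compact) subsets of `H^∞_{ν_β}`. -/
def CompactBlochToWeighted (α β : ℝ) (u φ : ℂ → ℂ) : Prop :=
  BoundedBlochToWeighted α β u φ ∧
    ∀ r : ℝ, ∀ ε : ℝ, 0 < ε → ∃ T : Finset (ℂ → ℂ),
      (∀ g ∈ T, MemWeighted β g) ∧
      ∀ f, MemBloch α f → blochNorm α f ≤ r →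
        ∃ g ∈ T, wnorm β (fun z => wcomp u φ f z - g z) ≤ ε

/-- A compact (linear, bounded, with totally bounded image of the unit ball) operator
from the subspace of `B^α` cut out by the predicate `P` into `Z_β`. -/
def IsCompactOpToZygmund (α β : ℝ) (P : (ℂ → ℂ) → Prop) (K : (ℂ → ℂ) → ℂ → ℂ) : Prop :=
  (∀ f g, P f → P g → ∀ a b : ℂ,
      K (fun z => a * f z + b * g z) = fun z => a * K f z + b * K g z) ∧
  (∀ f, P f → MemZygmund β (K f)) ∧
  (∃ C, ∀ f, P f → zygNorm β (K f) ≤ C * blochNorm α f) ∧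
  (∀ ε : ℝ, 0 < ε → ∃ T : Finset (ℂ → ℂ), (∀ g ∈ T, MemZygmund β g) ∧
      ∀ f, P f → blochNorm α f ≤ 1 → ∃ g ∈ T, zygNorm β (fun z => K f z - g z) ≤ ε)

/-- The essential norm of `uC_φ`, as an operator from the subspace of `B^α` cut out by
the predicate `P` into `Z_β`: the distance to the compact operators, the operator norm
being the supremum over the unit ball. -/
def essNormZ (α β : ℝ) (P : (ℂ → ℂ) → Prop) (u φ : ℂ → ℂ) : ℝ :=
  sInf {r | ∃ K, IsCompactOpToZygmund α β P K ∧
    r = sSup {s | ∃ f, P f ∧ blochNorm α f ≤ 1 ∧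
          s = zygNorm β (fun z => wcomp u φ f z - K f z)}}

/-- A compact (linear, bounded, with totally bounded image of the unit ball) operator
from `B^α` into `H^∞_{ν_β}`. -/
def IsCompactOpToWeighted (α β : ℝ) (K : (ℂ → ℂ) → ℂ → ℂ) : Prop :=
  (∀ f g, MemBloch α f → MemBloch α g → ∀ a b : ℂ,
      K (fun z => a * f z + b * g z) = fun z => a * K f z + b * K g z) ∧
  (∀ f, MemBloch α f → MemWeighted β (K f)) ∧
  (∃ C, ∀ f, MemBloch α f → wnorm β (K f) ≤ C * blochNorm α f) ∧
  (∀ ε : ℝ, 0 < ε → ∃ T : Finset (ℂ → ℂ), (∀ g ∈ T, MemWeighted β g) ∧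
      ∀ f, MemBloch α f → blochNorm α f ≤ 1 → ∃ g ∈ T, wnorm β (fun z => K f z - g z) ≤ ε)

/-- The essential norm of `uC_φ : B^α → H^∞_{ν_β}`. -/
def essNormW (α β : ℝ) (u φ : ℂ → ℂ) : ℝ :=
  sInf {r | ∃ K, IsCompactOpToWeighted α β K ∧
    r = sSup {s | ∃ f, MemBloch α f ∧ blochNorm α f ≤ 1 ∧
          s = wnorm β (fun z => wcomp u φ f z - K f z)}}

/-- `limsup_{|φ(z)|→1} F(z) = lim_{s→1⁻} sup {F z : z ∈ 𝔻, |φ z| > s}`.  Since the inner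
supremum is nonincreasing in `s`, the limit equals the infimum over `s ∈ [0,1)`; note
that `Real.sSup ∅ = 0`, matching the convention that the value is `0` when
`{z : |φ z| > s}` is empty for some `s < 1`. -/
def phiLimsup (φ : ℂ → ℂ) (F : ℂ → ℝ) : ℝ :=
  sInf ((fun s => sSup {y | ∃ z ∈ unitDisk, s < ‖φ z‖ ∧ y = F z}) '' Set.Ico (0:ℝ) 1)

lemma isOpen_unitDisk : IsOpen unitDisk := Metric.isOpen_ball

lemma mem_unitDisk {z : ℂ} : z ∈ unitDisk ↔ ‖z‖ < 1 := mem_ball_zero_iff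

lemma zero_mem_unitDisk : (0 : ℂ) ∈ unitDisk := by simp [mem_unitDisk]

lemma one_sub_normSq_pos {z : ℂ} (hz : z ∈ unitDisk) : 0 < 1 - ‖z‖ ^ 2 := by
  have h := mem_unitDisk.1 hz
  nlinarith [norm_nonneg z]

lemma one_sub_normSq_le_one (z : ℂ) : 1 - ‖z‖ ^ 2 ≤ 1 := by
  nlinarith [norm_nonneg z]

lemma weight_nonneg (γ : ℝ) {z : ℂ} (hz : z ∈ unitDisk) : 0 ≤ (1 - ‖z‖ ^ 2) ^ γ :=
  Real.rpow_nonneg (one_sub_normSq_pos hz).le γ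

lemma wnorm_le {γ C : ℝ} {g : ℂ → ℂ} (hC : 0 ≤ C)
    (h : ∀ z ∈ unitDisk, (1 - ‖z‖ ^ 2) ^ γ * ‖g z‖ ≤ C) : wnorm γ g ≤ C := by
  refine Real.sSup_le ?_ hC
  rintro _ ⟨z, hz, rfl⟩
  exact h z hz

lemma wnorm_nonneg (γ : ℝ) (g : ℂ → ℂ) : 0 ≤ wnorm γ g := by
  refine Real.sSup_nonneg ?_
  rintro _ ⟨z, hz, rfl⟩
  exact mul_nonneg (weight_nonneg γ hz) (norm_nonneg _)

lemma zygNorm_nonneg (β : ℝ) (f : ℂ → ℂ) : 0 ≤ zygNorm β f := by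
  have := wnorm_nonneg β (deriv (deriv f))
  unfold zygNorm
  positivity

lemma blochNorm_nonneg (α : ℝ) (f : ℂ → ℂ) : 0 ≤ blochNorm α f := by
  have := wnorm_nonneg α (deriv f)
  unfold blochNorm
  positivity

lemma MemBloch.weight_mul_le {α : ℝ} {f : ℂ → ℂ} (hf : MemBloch α f) {z : ℂ}
    (hz : z ∈ unitDisk) : (1 - ‖z‖ ^ 2) ^ α * ‖deriv f z‖ ≤ blochNorm α f :=
  (le_csSup hf.2 ⟨z, hz, rfl⟩).trans (le_add_of_nonneg_left (norm_nonneg _))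

lemma MemZygmund.weight_mul_le {β : ℝ} {f : ℂ → ℂ} (hf : MemZygmund β f) {z : ℂ}
    (hz : z ∈ unitDisk) : (1 - ‖z‖ ^ 2) ^ β * ‖deriv (deriv f) z‖ ≤ wnorm β (deriv (deriv f)) :=
  le_csSup hf.2 ⟨z, hz, rfl⟩

lemma memBloch_of_le {α C : ℝ} {f : ℂ → ℂ} (hf : DifferentiableOn ℂ f unitDisk)
    (h : ∀ z ∈ unitDisk, (1 - ‖z‖ ^ 2) ^ α * ‖deriv f z‖ ≤ C) : MemBloch α f := by
  refine ⟨hf, C, ?_⟩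
  rintro _ ⟨z, hz, rfl⟩
  exact h z hz

lemma memZygmund_of_le {β C : ℝ} {f : ℂ → ℂ} (hf : DifferentiableOn ℂ f unitDisk)
    (h : ∀ z ∈ unitDisk, (1 - ‖z‖ ^ 2) ^ β * ‖deriv (deriv f) z‖ ≤ C) : MemZygmund β f := by
  refine ⟨hf, C, ?_⟩
  rintro _ ⟨z, hz, rfl⟩
  exact h z hz

lemma differentiableAt_of_disk {f : ℂ → ℂ} (hf : DifferentiableOn ℂ f unitDisk) {z : ℂ}
    (hz : z ∈ unitDisk) : DifferentiableAt ℂ f z :=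
  hf.differentiableAt (isOpen_unitDisk.mem_nhds hz)

lemma deriv_linComb {f g : ℂ → ℂ} (hf : DifferentiableOn ℂ f unitDisk)
    (hg : DifferentiableOn ℂ g unitDisk) (a b : ℂ) {z : ℂ} (hz : z ∈ unitDisk) :
    deriv (fun z => a * f z + b * g z) z = a * deriv f z + b * deriv g z :=
  (((differentiableAt_of_disk hf hz).hasDerivAt.const_mul a).add
    ((differentiableAt_of_disk hg hz).hasDerivAt.const_mul b)).deriv

lemma deriv_deriv_linComb {f g : ℂ → ℂ} (hf : DifferentiableOn ℂ f unitDisk)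
    (hg : DifferentiableOn ℂ g unitDisk) (a b : ℂ) {z : ℂ} (hz : z ∈ unitDisk) :
    deriv (deriv (fun z => a * f z + b * g z)) z
      = a * deriv (deriv f) z + b * deriv (deriv g) z := by
  have h : deriv (fun z => a * f z + b * g z) =ᶠ[nhds z] fun z => a * deriv f z + b * deriv g z :=
    Filter.eventually_of_mem (isOpen_unitDisk.mem_nhds hz) fun w hw => deriv_linComb hf hg a b hw
  rw [h.deriv_eq, deriv_linComb (hf.deriv isOpen_unitDisk) (hg.deriv isOpen_unitDisk) a b hz]

lemma weight_linComb_le {x P Q : ℝ} (hx : 0 ≤ x) (a b v w : ℂ) (hv : x * ‖v‖ ≤ P)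
    (hw : x * ‖w‖ ≤ Q) : x * ‖a * v + b * w‖ ≤ ‖a‖ * P + ‖b‖ * Q := by
  calc x * ‖a * v + b * w‖ ≤ x * (‖a‖ * ‖v‖ + ‖b‖ * ‖w‖) := by
        gcongr
        exact (norm_add_le _ _).trans (by simp)
    _ = ‖a‖ * (x * ‖v‖) + ‖b‖ * (x * ‖w‖) := by ring
    _ ≤ _ := by gcongr

lemma differentiableOn_linComb {f g : ℂ → ℂ} (hf : DifferentiableOn ℂ f unitDisk)
    (hg : DifferentiableOn ℂ g unitDisk) (a b : ℂ) :
    DifferentiableOn ℂ (fun z => a * f z + b * g z) unitDisk :=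
  (hf.const_mul a).add (hg.const_mul b)

lemma MemBloch.linComb {α : ℝ} {f g : ℂ → ℂ} (hf : MemBloch α f) (hg : MemBloch α g) (a b : ℂ) :
    MemBloch α (fun z => a * f z + b * g z) := by
  refine memBloch_of_le (C := ‖a‖ * blochNorm α f + ‖b‖ * blochNorm α g)
    (differentiableOn_linComb hf.1 hg.1 a b) fun z hz => ?_
  rw [deriv_linComb hf.1 hg.1 a b hz]
  exact weight_linComb_le (weight_nonneg α hz) a b _ _ (hf.weight_mul_le hz) (hg.weight_mul_le hz)

lemma MemZygmund.linComb {β : ℝ} {f g : ℂ → ℂ} (hf : MemZygmund β f) (hg : MemZygmund β g)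
    (a b : ℂ) : MemZygmund β (fun z => a * f z + b * g z) := by
  refine memZygmund_of_le
    (C := ‖a‖ * wnorm β (deriv (deriv f)) + ‖b‖ * wnorm β (deriv (deriv g)))
    (differentiableOn_linComb hf.1 hg.1 a b) fun z hz => ?_
  rw [deriv_deriv_linComb hf.1 hg.1 a b hz]
  exact weight_linComb_le (weight_nonneg β hz) a b _ _ (hf.weight_mul_le hz) (hg.weight_mul_le hz)

lemma zygNorm_linComb_le {β : ℝ} {f g : ℂ → ℂ} (hf : MemZygmund β f) (hg : MemZygmund β g)
    (a b : ℂ) :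
    zygNorm β (fun z => a * f z + b * g z) ≤ ‖a‖ * zygNorm β f + ‖b‖ * zygNorm β g := by
  have h0 : ‖a * f 0 + b * g 0‖ ≤ ‖a‖ * ‖f 0‖ + ‖b‖ * ‖g 0‖ :=
    (norm_add_le _ _).trans (by simp)
  have h1 : ‖deriv (fun z => a * f z + b * g z) 0‖ ≤ ‖a‖ * ‖deriv f 0‖ + ‖b‖ * ‖deriv g 0‖ := by
    rw [deriv_linComb hf.1 hg.1 a b zero_mem_unitDisk]
    exact (norm_add_le _ _).trans (by simp)
  have h2 : wnorm β (deriv (deriv fun z => a * f z + b * g z))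
      ≤ ‖a‖ * wnorm β (deriv (deriv f)) + ‖b‖ * wnorm β (deriv (deriv g)) := by
    have := wnorm_nonneg β (deriv (deriv f))
    have := wnorm_nonneg β (deriv (deriv g))
    refine wnorm_le (by positivity) fun z hz => ?_
    rw [deriv_deriv_linComb hf.1 hg.1 a b hz]
    exact weight_linComb_le (weight_nonneg β hz) a b _ _ (hf.weight_mul_le hz)
      (hg.weight_mul_le hz)
  unfold zygNorm
  linarith

lemma MemZygmund.sub {β : ℝ} {f g : ℂ → ℂ} (hf : MemZygmund β f) (hg : MemZygmund β g) :
    MemZygmund β (fun z => f z - g z) := by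
  simpa [sub_eq_add_neg] using hf.linComb hg 1 (-1)

lemma zygNorm_sub_le {β : ℝ} {f g : ℂ → ℂ} (hf : MemZygmund β f) (hg : MemZygmund β g) :
    zygNorm β (fun z => f z - g z) ≤ zygNorm β f + zygNorm β g := by
  simpa [sub_eq_add_neg] using zygNorm_linComb_le hf hg 1 (-1)

lemma zygNorm_add_le {β : ℝ} {f g : ℂ → ℂ} (hf : MemZygmund β f) (hg : MemZygmund β g) :
    zygNorm β (fun z => f z + g z) ≤ zygNorm β f + zygNorm β g := by
  simpa using zygNorm_linComb_le hf hg 1 1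

lemma zygNorm_le_sub_add {β : ℝ} {f g : ℂ → ℂ} (hf : MemZygmund β f) (hg : MemZygmund β g) :
    zygNorm β f ≤ zygNorm β (fun z => f z - g z) + zygNorm β g := by
  simpa using zygNorm_add_le (hf.sub hg) hg

lemma zygNorm_const_mul {β : ℝ} {f : ℂ → ℂ} (a : ℂ) :
    zygNorm β (fun z => a * f z) = ‖a‖ * zygNorm β f := by
  have h1 : deriv (fun z => a * f z) = fun z => a * deriv f z := by
    ext z; exact deriv_const_mul_field a
  have h2 : deriv (fun z => a * deriv f z) = fun z => a * deriv (deriv f) z := by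
    ext z; exact deriv_const_mul_field a
  have h3 : wnorm β (fun z => a * deriv (deriv f) z) = ‖a‖ * wnorm β (deriv (deriv f)) := by
    unfold wnorm
    rw [← smul_eq_mul (a := ‖a‖), ← Real.sSup_smul_of_nonneg (norm_nonneg a), ← Set.image_smul,
      Set.image_image]
    congr 1
    refine Set.image_congr fun z _ => ?_
    simp only [norm_mul, smul_eq_mul]
    ring
  simp only [zygNorm, h1, h2, h3, norm_mul]
  ring

lemma deriv_wcomp {u φ f : ℂ → ℂ} (hu : DifferentiableOn ℂ u unitDisk)
    (hφ : DifferentiableOn ℂ φ unitDisk) (hm : Set.MapsTo φ unitDisk unitDisk)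
    (hf : DifferentiableOn ℂ f unitDisk) {z : ℂ} (hz : z ∈ unitDisk) :
    deriv (wcomp u φ f) z = deriv u z * f (φ z) + u z * (deriv f (φ z) * deriv φ z) := by
  have h1 := (differentiableAt_of_disk hu hz).hasDerivAt
  have h2 := (differentiableAt_of_disk hφ hz).hasDerivAt
  have h3 := (differentiableAt_of_disk hf (hm hz)).hasDerivAt
  exact (h1.mul (h3.comp z h2)).deriv

lemma deriv_deriv_wcomp {u φ f : ℂ → ℂ} (hu : DifferentiableOn ℂ u unitDisk)
    (hφ : DifferentiableOn ℂ φ unitDisk) (hm : Set.MapsTo φ unitDisk unitDisk)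
    (hf : DifferentiableOn ℂ f unitDisk) {z : ℂ} (hz : z ∈ unitDisk) :
    deriv (deriv (wcomp u φ f)) z = deriv (deriv u) z * f (φ z)
      + (2 * deriv u z * deriv φ z + u z * deriv (deriv φ) z) * deriv f (φ z)
      + u z * deriv φ z ^ 2 * deriv (deriv f) (φ z) := by
  have h : deriv (wcomp u φ f) =ᶠ[nhds z]
      fun z => deriv u z * f (φ z) + u z * (deriv f (φ z) * deriv φ z) :=
    Filter.eventually_of_mem (isOpen_unitDisk.mem_nhds hz) fun w hw => deriv_wcomp hu hφ hm hf hw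
  have h1 := (differentiableAt_of_disk hu hz).hasDerivAt
  have h2 := (differentiableAt_of_disk hφ hz).hasDerivAt
  have h3 := (differentiableAt_of_disk hf (hm hz)).hasDerivAt
  have h1' := (differentiableAt_of_disk (hu.deriv isOpen_unitDisk) hz).hasDerivAt
  have h2' := (differentiableAt_of_disk (hφ.deriv isOpen_unitDisk) hz).hasDerivAt
  have h3' := (differentiableAt_of_disk (hf.deriv isOpen_unitDisk) (hm hz)).hasDerivAt
  rw [h.deriv_eq]
  refine ((h1'.mul (h3.comp z h2)).add (h1.mul ((h3'.comp z h2).mul h2'))).deriv.trans ?_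
  simp only [Function.comp, Pi.mul_apply]
  ring

lemma sum_min_div_le_four (y : ℕ → ℝ) (hy : ∀ n, 0 < y n) (hstep : ∀ n, y (n + 1) ≤ y n / 2)
    {x : ℝ} (hx : 0 < x) (N : ℕ) :
    ∑ n ∈ Finset.range N, min (x / y n) (y n / x) ≤ 4 := by
  have key : ∀ N, (x ≤ y N → ∑ n ∈ Finset.range (N + 1), min (x / y n) (y n / x) ≤ 2 * (x / y N)) ∧
      (y N < x → ∑ n ∈ Finset.range (N + 1), min (x / y n) (y n / x) ≤ 4 - y N / x) := by
    intro N
    induction N with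
    | zero =>
      have h1 : 0 < x / y 0 := div_pos hx (hy 0)
      simp only [zero_add, Finset.range_one, Finset.sum_singleton]
      refine ⟨fun _ => (min_le_left _ _).trans (by linarith), fun h => ?_⟩
      have h2 : y 0 / x ≤ 1 := (div_le_one hx).2 h.le
      exact (min_le_right _ _).trans (by linarith)
    | succ N ih =>
      have hs := hstep N
      have hy1 := hy (N + 1)
      rw [Finset.sum_range_succ]
      constructor
      · intro h
        have h1 : x ≤ y N := by linarith
        have h2 : 2 * (x / y N) ≤ x / y (N + 1) := by
          rw [← mul_div_assoc, div_le_div_iff₀ (hy N) hy1]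
          nlinarith
        have := ih.1 h1
        have := min_le_left (x / y (N + 1)) (y (N + 1) / x)
        linarith
      · intro h
        have h3 := min_le_right (x / y (N + 1)) (y (N + 1) / x)
        rcases le_or_gt x (y N) with h1 | h1
        · have h2 : x / y N ≤ 1 := (div_le_one (hy N)).2 h1
          have h4 : y (N + 1) / x ≤ 1 := (div_le_one hx).2 h.le
          have := ih.1 h1
          linarith
        · have h4 : y (N + 1) / x ≤ y N / x / 2 := by
            rw [div_right_comm]
            gcongr
          have := ih.2 h1
          linarith
  rcases N with _ | N
  · simp
  · rcases le_or_gt x (y N) with h | h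
    · have := (key N).1 h
      have h2 : x / y N ≤ 1 := (div_le_one (hy N)).2 h
      linarith
    · have := (key N).2 h
      have h2 : 0 < y N / x := div_pos (hy N) hx
      linarith

lemma exists_lacunary_seq {p : ℂ → Prop}
    (h : ∀ s : ℝ, s < 1 → ∃ a ∈ unitDisk, s < ‖a‖ ∧ p a) :
    ∃ a : ℕ → ℂ, (∀ n, a n ∈ unitDisk ∧ p (a n)) ∧
      ∀ n, 1 - ‖a (n + 1)‖ ^ 2 ≤ (1 - ‖a n‖ ^ 2) / 2 := by
  have next : ∀ a : {a : ℂ // a ∈ unitDisk ∧ p a},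
      ∃ b : {a : ℂ // a ∈ unitDisk ∧ p a}, 1 - ‖b.1‖ ^ 2 ≤ (1 - ‖a.1‖ ^ 2) / 2 := by
    rintro ⟨a, ha, -⟩
    have ha1 := mem_unitDisk.1 ha
    obtain ⟨b, hb, hab, hpb⟩ := h ((3 + ‖a‖) / 4) (by linarith)
    refine ⟨⟨b, hb, hpb⟩, ?_⟩
    have hb1 := mem_unitDisk.1 hb
    have := norm_nonneg a
    have := norm_nonneg b
    simp only
    nlinarith
  choose nx hnx using next
  obtain ⟨a0, ha0, -, hp0⟩ := h 0 one_pos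
  let seq : ℕ → {a : ℂ // a ∈ unitDisk ∧ p a} := fun n => Nat.rec ⟨a0, ha0, hp0⟩ (fun _ b => nx b) n
  exact ⟨fun n => (seq n).1, fun n => (seq n).2, fun n => hnx (seq n)⟩

lemma zygNorm_map_sum_sub_le {α β ε : ℝ} {K : (ℂ → ℂ) → ℂ → ℂ}
    (hK : IsCompactOpToZygmund α β (MemBloch α) K) {t : ℕ → ℂ → ℂ}
    (ht : ∀ n, MemBloch α (t n)) {g : ℂ → ℂ} (hg : MemZygmund β g) (F : Finset ℕ)
    (hF : ∀ n ∈ F, zygNorm β (fun z => K (t n) z - g z) ≤ ε) :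
    MemBloch α (fun z => ∑ n ∈ F, t n z) ∧
      zygNorm β (fun z => K (fun z => ∑ n ∈ F, t n z) z - F.card * g z) ≤ F.card * ε := by
  induction F using Finset.induction_on with
  | empty =>
    have h0 : MemBloch α (fun _ => (0 : ℂ)) :=
      memBloch_of_le (C := 0) (differentiableOn_const 0) (by simp)
    have hK0 : K (fun _ => (0 : ℂ)) = fun _ => 0 := by
      simpa using hK.1 _ _ h0 h0 0 0
    refine ⟨by simpa using h0, ?_⟩
    have := zygNorm_const_mul (β := β) (f := fun _ => (0 : ℂ)) 0
    simp only [mul_zero, norm_zero, zero_mul] at this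
    simp [hK0, this]
  | insert m F hm ih =>
    obtain ⟨h1, h2⟩ := ih fun n hn => hF n (Finset.mem_insert_of_mem hn)
    have h3 := hF m (Finset.mem_insert_self m F)
    have hsum : (fun z => ∑ n ∈ insert m F, t n z)
        = fun z => 1 * t m z + 1 * ∑ n ∈ F, t n z := by
      ext z
      rw [Finset.sum_insert hm, one_mul, one_mul]
    rw [hsum]
    refine ⟨(ht m).linComb h1 1 1, ?_⟩
    rw [hK.1 _ _ (ht m) h1 1 1, Finset.card_insert_of_notMem hm]
    have hcg : MemZygmund β (fun z => (F.card : ℂ) * g z) := by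
      simpa using hg.linComb hg (F.card : ℂ) 0
    have h4 := zygNorm_add_le ((hK.2.1 _ (ht m)).sub hg) ((hK.2.1 _ h1).sub hcg)
    have h5 : (fun z => 1 * K (t m) z + 1 * K (fun z => ∑ n ∈ F, t n z) z
          - ((F.card + 1 : ℕ) : ℂ) * g z)
        = fun z => (K (t m) z - g z) + (K (fun z => ∑ n ∈ F, t n z) z - F.card * g z) := by
      ext z
      push_cast
      ring
    rw [h5]
    push_cast
    linarith

lemma blochNorm_sum_le {α : ℝ} {t : ℂ → ℂ → ℂ} (ht : ∀ a ∈ unitDisk, MemBloch α (t a))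
    (h0 : ∀ a ∈ unitDisk, ‖t a 0‖ ≤ (1 - ‖a‖ ^ 2) / 2)
    (hd : ∀ a ∈ unitDisk, ∀ z ∈ unitDisk, (1 - ‖z‖ ^ 2) ^ α * ‖deriv (t a) z‖ ≤
      min ((1 - ‖z‖ ^ 2) / (1 - ‖a‖ ^ 2)) ((1 - ‖a‖ ^ 2) / (1 - ‖z‖ ^ 2)) / 2)
    {a : ℕ → ℂ} (ha : ∀ n, a n ∈ unitDisk)
    (hstep : ∀ n, 1 - ‖a (n + 1)‖ ^ 2 ≤ (1 - ‖a n‖ ^ 2) / 2) (F : Finset ℕ) :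
    blochNorm α (fun z => ∑ n ∈ F, t (a n) z) ≤ 4 := by
  have hy : ∀ n, 0 < 1 - ‖a n‖ ^ 2 := fun n => one_sub_normSq_pos (ha n)
  have hsum : ∀ x : ℝ, 0 < x →
      ∑ n ∈ F, min (x / (1 - ‖a n‖ ^ 2)) ((1 - ‖a n‖ ^ 2) / x) / 2 ≤ 2 := by
    intro x hx
    have hFr : F ⊆ Finset.range (F.sup id + 1) := fun n hn =>
      Finset.mem_range.2 (Nat.lt_succ_of_le (Finset.le_sup (f := id) hn))
    have h1 := sum_min_div_le_four (fun n => 1 - ‖a n‖ ^ 2) hy hstep hx (F.sup id + 1)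
    have h2 := Finset.sum_le_sum_of_subset_of_nonneg
      (f := fun n => min (x / (1 - ‖a n‖ ^ 2)) ((1 - ‖a n‖ ^ 2) / x)) hFr fun n _ _ =>
        le_min (div_pos hx (hy n)).le (div_pos (hy n) hx).le
    rw [← Finset.sum_div]
    linarith
  have hA : ‖∑ n ∈ F, t (a n) 0‖ ≤ 2 := by
    refine (norm_sum_le _ _).trans (le_trans (Finset.sum_le_sum fun n _ => ?_) (hsum 1 one_pos))
    have h1 : 1 - ‖a n‖ ^ 2 ≤ 1 := one_sub_normSq_le_one _
    have h2 : 1 - ‖a n‖ ^ 2 ≤ 1 / (1 - ‖a n‖ ^ 2) := by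
      rw [le_div_iff₀ (hy n)]
      nlinarith [hy n]
    rw [div_one, min_eq_right h2]
    exact h0 _ (ha n)
  have hB : wnorm α (deriv fun z => ∑ n ∈ F, t (a n) z) ≤ 2 := by
    refine wnorm_le zero_le_two fun z hz => ?_
    rw [deriv_fun_sum fun n _ => differentiableAt_of_disk (ht _ (ha n)).1 hz]
    calc (1 - ‖z‖ ^ 2) ^ α * ‖∑ n ∈ F, deriv (t (a n)) z‖
        ≤ (1 - ‖z‖ ^ 2) ^ α * ∑ n ∈ F, ‖deriv (t (a n)) z‖ :=
          mul_le_mul_of_nonneg_left (norm_sum_le _ _) (weight_nonneg α hz)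
      _ = ∑ n ∈ F, (1 - ‖z‖ ^ 2) ^ α * ‖deriv (t (a n)) z‖ := Finset.mul_sum _ _ _
      _ ≤ _ := Finset.sum_le_sum fun n _ => hd _ (ha n) z hz
      _ ≤ 2 := hsum _ (one_sub_normSq_pos hz)
  unfold blochNorm
  linarith

/-- Compact operators send localized families of functions, concentrating at the boundary, to
functions of small norm. -/
lemma IsCompactOpToZygmund.exists_zygNorm_le {α β : ℝ} {K : (ℂ → ℂ) → ℂ → ℂ}
    (hK : IsCompactOpToZygmund α β (MemBloch α) K) {t : ℂ → ℂ → ℂ}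
    (ht : ∀ a ∈ unitDisk, MemBloch α (t a)) (hb : ∀ a ∈ unitDisk, blochNorm α (t a) ≤ 1)
    (h0 : ∀ a ∈ unitDisk, ‖t a 0‖ ≤ (1 - ‖a‖ ^ 2) / 2)
    (hd : ∀ a ∈ unitDisk, ∀ z ∈ unitDisk, (1 - ‖z‖ ^ 2) ^ α * ‖deriv (t a) z‖ ≤
      min ((1 - ‖z‖ ^ 2) / (1 - ‖a‖ ^ 2)) ((1 - ‖a‖ ^ 2) / (1 - ‖z‖ ^ 2)) / 2)
    {δ : ℝ} (hδ : 0 < δ) :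
    ∃ s : ℝ, s < 1 ∧ ∀ a ∈ unitDisk, s < ‖a‖ → zygNorm β (K (t a)) ≤ δ := by
  by_contra! hcon
  obtain ⟨a, ha, hstep⟩ := exists_lacunary_seq hcon
  obtain ⟨C, hC⟩ := hK.2.2.1
  obtain ⟨T, hT, hTa⟩ := hK.2.2.2 (δ / 4) (by positivity)
  choose g hgT hg using fun n => hTa (t (a n)) (ht _ (ha n).1) (hb _ (ha n).1)
  obtain ⟨⟨g₀, hg₀⟩, hinf⟩ := Finite.exists_infinite_fiber (fun n => (⟨g n, hgT n⟩ : T))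
  obtain ⟨N, hN⟩ := exists_nat_gt (16 * |C| / δ)
  obtain ⟨F, hFs, hFc⟩ := (Set.infinite_coe_iff.1 hinf).exists_subset_card_eq N
  have hFg : ∀ n ∈ F, zygNorm β (fun z => K (t (a n)) z - g₀ z) ≤ δ / 4 := by
    intro n hn
    have h1 : g n = g₀ := congrArg Subtype.val (hFs hn)
    rw [← h1]
    exact hg n
  have hN0 : (0 : ℝ) < N := lt_of_le_of_lt (by positivity) hN
  have hFne : F.Nonempty := by
    rw [← Finset.card_pos, hFc]
    exact_mod_cast hN0
  obtain ⟨m, hm⟩ := hFne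
  have hzg := hT g₀ hg₀
  obtain ⟨hS, hSn⟩ := zygNorm_map_sum_sub_le hK (fun n => ht _ (ha n).1) hzg F hFg
  rw [hFc] at hSn
  have hSb := blochNorm_sum_le ht h0 hd (fun n => (ha n).1) hstep F
  have hKS := hC _ hS
  have hNg : MemZygmund β (fun z => (N : ℂ) * g₀ z) := by
    simpa using hzg.linComb hzg (N : ℂ) 0
  have h1 := zygNorm_sub_le (hK.2.1 _ hS) ((hK.2.1 _ hS).sub hNg)
  have h2 : zygNorm β (fun z => (N : ℂ) * g₀ z) = N * zygNorm β g₀ := by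
    rw [zygNorm_const_mul]
    simp
  simp only [sub_sub_cancel] at h1
  rw [h2] at h1
  have h3 : C * blochNorm α (fun z => ∑ n ∈ F, t (a n) z) ≤ 4 * |C| := by
    nlinarith [le_abs_self C, abs_nonneg C, blochNorm_nonneg α (fun z => ∑ n ∈ F, t (a n) z)]
  have h4 := zygNorm_le_sub_add (hK.2.1 _ (ht _ (ha m).1)) hzg
  have h5 := hFg m hm
  have h6 := (ha m).2
  have h7 : 16 * |C| < N * δ := by rwa [div_lt_iff₀ hδ] at hN
  have h8 : δ / 2 < zygNorm β g₀ := by linarith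
  nlinarith

/-- The function `z ↦ (1 - ā z)^(-q)`. -/
def kernelPow (q : ℝ) (a z : ℂ) : ℂ := (1 - starRingEnd ℂ a * z) ^ (-(q : ℂ))

lemma norm_conj_mul_lt_one {a z : ℂ} (ha : a ∈ unitDisk) (hz : z ∈ unitDisk) :
    ‖starRingEnd ℂ a * z‖ < 1 := by
  rw [norm_mul, RCLike.norm_conj]
  have := mem_unitDisk.1 ha
  have := mem_unitDisk.1 hz
  nlinarith [norm_nonneg a, norm_nonneg z]

lemma one_sub_conj_mul_mem_slitPlane {a z : ℂ} (ha : a ∈ unitDisk) (hz : z ∈ unitDisk) :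
    1 - starRingEnd ℂ a * z ∈ slitPlane := by
  rw [sub_eq_add_neg]
  exact mem_slitPlane_of_norm_lt_one (by simpa using norm_conj_mul_lt_one ha hz)

lemma hasDerivAt_kernelPow (q : ℝ) {a z : ℂ} (ha : a ∈ unitDisk) (hz : z ∈ unitDisk) :
    HasDerivAt (kernelPow q a) (q * starRingEnd ℂ a * kernelPow (q + 1) a z) z := by
  have h1 : HasDerivAt (fun z => 1 - starRingEnd ℂ a * z) (-(starRingEnd ℂ a)) z := by
    simpa using ((hasDerivAt_id z).const_mul (starRingEnd ℂ a)).const_sub 1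
  have h2 := h1.cpow_const (c := -(q : ℂ)) (one_sub_conj_mul_mem_slitPlane ha hz)
  refine h2.congr_deriv ?_
  have h3 : -(q : ℂ) - 1 = -((q + 1 : ℝ) : ℂ) := by push_cast; ring
  rw [h3, kernelPow]
  ring

lemma norm_kernelPow (q : ℝ) (a z : ℂ) :
    ‖kernelPow q a z‖ = ‖1 - starRingEnd ℂ a * z‖ ^ (-q) := by
  rw [kernelPow, ← ofReal_neg, norm_cpow_real]

lemma kernelPow_zero (q : ℝ) (a : ℂ) : kernelPow q a 0 = 1 := by simp [kernelPow]

lemma kernelPow_self (q : ℝ) {a : ℂ} (ha : a ∈ unitDisk) :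
    kernelPow q a a = (((1 - ‖a‖ ^ 2) ^ (-q) : ℝ) : ℂ) := by
  rw [ofReal_cpow (one_sub_normSq_pos ha).le, kernelPow, mul_comm, mul_conj, normSq_eq_norm_sq]
  push_cast
  rfl

/-- A constant normalizing the test functions `testFn` in the Bloch norm. -/
def testConst (α : ℝ) : ℝ := 1 / (2 * ((α + 2) * 2 ^ (α + 3)))

lemma testConst_pos {α : ℝ} (hα : 1 < α) : 0 < testConst α := by
  unfold testConst
  positivity

lemma testConst_le {α : ℝ} (hα : 1 < α) : testConst α ≤ 1 / 2 := by
  unfold testConst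
  have : (1 : ℝ) ≤ 2 ^ (α + 3) := Real.one_le_rpow one_le_two (by linarith)
  apply one_div_le_one_div_of_le <;> nlinarith

/-- The normalized test functions `c (1 - |a|²)^k / (1 - ā z)^(α - 1 + k)`. -/
def testFn (α : ℝ) (k : ℕ) (a z : ℂ) : ℂ :=
  ((testConst α * (1 - ‖a‖ ^ 2) ^ k : ℝ) : ℂ) * kernelPow (α - 1 + k) a z

lemma deriv_testFn (α : ℝ) (k : ℕ) {a z : ℂ} (ha : a ∈ unitDisk) (hz : z ∈ unitDisk) :
    deriv (testFn α k a) z = ((testConst α * (1 - ‖a‖ ^ 2) ^ k : ℝ) : ℂ) *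
      (((α - 1 + k : ℝ) : ℂ) * starRingEnd ℂ a * kernelPow (α - 1 + k + 1) a z) :=
  ((hasDerivAt_kernelPow _ ha hz).const_mul _).deriv

lemma deriv_deriv_testFn (α : ℝ) (k : ℕ) {a z : ℂ} (ha : a ∈ unitDisk) (hz : z ∈ unitDisk) :
    deriv (deriv (testFn α k a)) z = ((testConst α * (1 - ‖a‖ ^ 2) ^ k : ℝ) : ℂ) *
      (((α - 1 + k : ℝ) : ℂ) * starRingEnd ℂ a * (((α - 1 + k + 1 : ℝ) : ℂ) * starRingEnd ℂ a *
        kernelPow (α - 1 + k + 1 + 1) a z)) := by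
  have h : deriv (testFn α k a) =ᶠ[nhds z] fun z => ((testConst α * (1 - ‖a‖ ^ 2) ^ k : ℝ) : ℂ) *
      (((α - 1 + k : ℝ) : ℂ) * starRingEnd ℂ a * kernelPow (α - 1 + k + 1) a z) :=
    Filter.eventually_of_mem (isOpen_unitDisk.mem_nhds hz) fun w hw => deriv_testFn α k ha hw
  rw [h.deriv_eq]
  exact (((hasDerivAt_kernelPow _ ha hz).const_mul _).const_mul _).deriv

lemma differentiableOn_testFn (α : ℝ) (k : ℕ) {a : ℂ} (ha : a ∈ unitDisk) :
    DifferentiableOn ℂ (testFn α k a) unitDisk := fun _ hz =>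
  ((hasDerivAt_kernelPow _ ha hz).const_mul _).differentiableAt.differentiableWithinAt

lemma rpow_mul_pow_mul_rpow_neg_le {α x y D : ℝ} (hα : 1 < α) {k : ℕ} (hk : 1 ≤ k) (hk3 : k ≤ 3)
    (hx : 0 < x) (hy : 0 < y) (hxD : x ≤ 2 * D) (hyD : y ≤ 2 * D) :
    x ^ α * y ^ k * D ^ (-(α - 1 + k + 1)) ≤ 2 ^ (α + 3) * min (x / y) (y / x) := by
  have hD : 0 < 2 * D := by linarith
  have hD' : 0 < D := by linarith
  have h1 : x ^ α * y ^ k * D ^ (-(α - 1 + k + 1))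
      = 2 ^ (α + k) * ((x / (2 * D)) ^ α * (y / (2 * D)) ^ k) := by
    rw [Real.div_rpow hx.le hD.le, div_pow, Real.mul_rpow zero_le_two hD'.le, mul_pow,
      Real.rpow_neg hD'.le, show α - 1 + k + 1 = α + k by ring, Real.rpow_add hD',
      Real.rpow_add two_pos, Real.rpow_natCast, Real.rpow_natCast]
    field_simp
  have h2 : (2 : ℝ) ^ (α + k) ≤ 2 ^ (α + 3) := by
    apply Real.rpow_le_rpow_of_exponent_le one_le_two
    have : (k : ℝ) ≤ 3 := by exact_mod_cast hk3
    linarith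
  have hx1 : x / (2 * D) ≤ 1 := (div_le_one hD).2 hxD
  have hy1 : y / (2 * D) ≤ 1 := (div_le_one hD).2 hyD
  have hx0 : 0 < x / (2 * D) := div_pos hx hD
  have hy0 : 0 < y / (2 * D) := div_pos hy hD
  have h3 : (x / (2 * D)) ^ α ≤ x / (2 * D) := by
    simpa using Real.rpow_le_rpow_of_exponent_ge hx0 hx1 hα.le
  have h4 : (y / (2 * D)) ^ k ≤ y / (2 * D) := by
    simpa using pow_le_pow_of_le_one hy0.le hy1 hk
  have h5 : 0 ≤ (x / (2 * D)) ^ α := Real.rpow_nonneg hx0.le _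
  have h6 : 0 ≤ (y / (2 * D)) ^ k := by positivity
  have h7 : x / (2 * D) ≤ x / y := by gcongr
  have h8 : y / (2 * D) ≤ y / x := by gcongr
  rw [h1]
  refine mul_le_mul h2 (le_min ?_ ?_) (by positivity) (by positivity)
  · calc _ ≤ x / (2 * D) * 1 := mul_le_mul h3 (h4.trans hy1) h6 hx0.le
      _ ≤ x / y := by rwa [mul_one]
  · calc _ ≤ 1 * (y / (2 * D)) := mul_le_mul (h3.trans hx1) h4 h6 zero_le_one
      _ ≤ y / x := by rwa [one_mul]

lemma weight_mul_deriv_testFn_le {α : ℝ} (hα : 1 < α) {k : ℕ} (hk : 1 ≤ k) (hk3 : k ≤ 3)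
    {a z : ℂ} (ha : a ∈ unitDisk) (hz : z ∈ unitDisk) :
    (1 - ‖z‖ ^ 2) ^ α * ‖deriv (testFn α k a) z‖ ≤
      min ((1 - ‖z‖ ^ 2) / (1 - ‖a‖ ^ 2)) ((1 - ‖a‖ ^ 2) / (1 - ‖z‖ ^ 2)) / 2 := by
  have hx := one_sub_normSq_pos hz
  have hy := one_sub_normSq_pos ha
  have ha1 := mem_unitDisk.1 ha
  have hz1 := mem_unitDisk.1 hz
  have ha0 := norm_nonneg a
  have hz0 := norm_nonneg z
  have hk' : (k : ℝ) ≤ 3 := by exact_mod_cast hk3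
  have hk1 : (1 : ℝ) ≤ k := by exact_mod_cast hk
  have hD : 1 - ‖a‖ * ‖z‖ ≤ ‖1 - starRingEnd ℂ a * z‖ := by
    have := norm_sub_norm_le (1 : ℂ) (starRingEnd ℂ a * z)
    simpa using this
  have hxD : 1 - ‖z‖ ^ 2 ≤ 2 * ‖1 - starRingEnd ℂ a * z‖ := by nlinarith
  have hyD : 1 - ‖a‖ ^ 2 ≤ 2 * ‖1 - starRingEnd ℂ a * z‖ := by nlinarith
  have key := rpow_mul_pow_mul_rpow_neg_le hα hk hk3 hx hy hxD hyD
  set m := min ((1 - ‖z‖ ^ 2) / (1 - ‖a‖ ^ 2)) ((1 - ‖a‖ ^ 2) / (1 - ‖z‖ ^ 2)) with hm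
  have hm0 : 0 ≤ m := le_min (div_pos hx hy).le (div_pos hy hx).le
  have hc := testConst_pos hα
  rw [deriv_testFn α k ha hz, norm_mul, norm_mul, norm_mul, norm_kernelPow, RCLike.norm_conj,
    norm_real, norm_real, Real.norm_of_nonneg (by positivity),
    Real.norm_of_nonneg (by linarith : 0 ≤ α - 1 + k)]
  have hp : (α - 1 + k) * ‖a‖ ≤ α + 2 := by nlinarith
  calc _ = testConst α * ((α - 1 + k) * ‖a‖) * ((1 - ‖z‖ ^ 2) ^ α * (1 - ‖a‖ ^ 2) ^ k *
        ‖1 - starRingEnd ℂ a * z‖ ^ (-(α - 1 + k + 1))) := by ring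
    _ ≤ testConst α * (α + 2) * (2 ^ (α + 3) * m) := by
        refine mul_le_mul (by gcongr) key ?_ (by positivity)
        exact mul_nonneg (mul_nonneg (weight_nonneg α hz) (by positivity))
          (Real.rpow_nonneg (norm_nonneg _) _)
    _ = m / 2 := by
        unfold testConst
        have : (0 : ℝ) < 2 ^ (α + 3) := by positivity
        have : 0 < α + 2 := by linarith
        field_simp

lemma norm_testFn_zero_le {α : ℝ} (hα : 1 < α) {k : ℕ} (hk : 1 ≤ k) {a : ℂ} (ha : a ∈ unitDisk) :
    ‖testFn α k a 0‖ ≤ (1 - ‖a‖ ^ 2) / 2 := by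
  have hy := one_sub_normSq_pos ha
  have h1 : (1 - ‖a‖ ^ 2) ^ k ≤ 1 - ‖a‖ ^ 2 := by
    simpa using pow_le_pow_of_le_one hy.le (one_sub_normSq_le_one a) hk
  have hc := testConst_pos hα
  have hc' := testConst_le hα
  rw [testFn, kernelPow_zero, mul_one, norm_real, Real.norm_of_nonneg (by positivity)]
  nlinarith [pow_pos hy k]

lemma memBloch_testFn {α : ℝ} (hα : 1 < α) {k : ℕ} (hk : 1 ≤ k) (hk3 : k ≤ 3)
    {a : ℂ} (ha : a ∈ unitDisk) : MemBloch α (testFn α k a) ∧ blochNorm α (testFn α k a) ≤ 1 := by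
  have key : ∀ z ∈ unitDisk, (1 - ‖z‖ ^ 2) ^ α * ‖deriv (testFn α k a) z‖ ≤ 1 / 2 := by
    intro z hz
    refine (weight_mul_deriv_testFn_le hα hk hk3 ha hz).trans ?_
    have hx := one_sub_normSq_pos hz
    have hy := one_sub_normSq_pos ha
    gcongr
    rcases le_total (1 - ‖z‖ ^ 2) (1 - ‖a‖ ^ 2) with h | h
    · exact (min_le_left _ _).trans ((div_le_one hy).2 h)
    · exact (min_le_right _ _).trans ((div_le_one hx).2 h)
  refine ⟨memBloch_of_le (differentiableOn_testFn α k ha) key, ?_⟩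
  have h1 := norm_testFn_zero_le hα hk ha
  have h2 := wnorm_le (by norm_num) key
  have h3 := one_sub_normSq_le_one a
  unfold blochNorm
  linarith

lemma norm_le_of_quadratic_combinations {p Q : ℝ} (hp : 0 ≤ p) {A B C : ℂ}
    (h1 : ‖A + p * B + p * (p + 1) * C‖ ≤ Q)
    (h2 : ‖A + (p + 1) * B + (p + 1) * (p + 2) * C‖ ≤ Q)
    (h3 : ‖A + (p + 2) * B + (p + 2) * (p + 3) * C‖ ≤ Q) :
    ‖A‖ ≤ (6 * p ^ 2 + 8 * p + 6) * Q ∧ ‖B‖ ≤ (6 * p ^ 2 + 8 * p + 6) * Q ∧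
      ‖C‖ ≤ (6 * p ^ 2 + 8 * p + 6) * Q := by
  set S1 := A + p * B + p * (p + 1) * C with hS1
  set S2 := A + (p + 1) * B + (p + 1) * (p + 2) * C with hS2
  set S3 := A + (p + 2) * B + (p + 2) * (p + 3) * C with hS3
  have hQ : 0 ≤ Q := (norm_nonneg _).trans h1
  have hC : 2 * ‖C‖ ≤ 4 * Q := by
    have : (2 : ℂ) * C = S3 - S2 - (S2 - S1) := by rw [hS1, hS2, hS3]; ring
    have h := congrArg norm this
    rw [norm_mul, Complex.norm_two] at h
    have a1 := norm_sub_le (S3 - S2) (S2 - S1)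
    have a2 := norm_sub_le S3 S2
    have a3 := norm_sub_le S2 S1
    linarith
  have hB : ‖B‖ ≤ 2 * Q + 2 * (p + 1) * ‖C‖ := by
    have : B = S2 - S1 - ((2 * (p + 1) : ℝ) : ℂ) * C := by
      rw [hS1, hS2]; push_cast; ring
    have h := congrArg norm this
    have a1 := norm_sub_le (S2 - S1) (((2 * (p + 1) : ℝ) : ℂ) * C)
    have a2 := norm_sub_le S2 S1
    rw [norm_mul, norm_real, Real.norm_of_nonneg (by positivity)] at a1
    linarith
  have hA : ‖A‖ ≤ Q + p * ‖B‖ + p * (p + 1) * ‖C‖ := by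
    have : A = S1 - (p : ℂ) * B - ((p * (p + 1) : ℝ) : ℂ) * C := by
      rw [hS1]; push_cast; ring
    have h := congrArg norm this
    have a1 := norm_sub_le (S1 - (p : ℂ) * B) (((p * (p + 1) : ℝ) : ℂ) * C)
    have a2 := norm_sub_le S1 ((p : ℂ) * B)
    rw [norm_mul, norm_real, Real.norm_of_nonneg (by positivity)] at a1 a2
    linarith
  have hC' : ‖C‖ ≤ 2 * Q := by linarith
  have hB' : ‖B‖ ≤ (4 * p + 6) * Q := by nlinarith
  have hA' : ‖A‖ ≤ (6 * p ^ 2 + 8 * p + 1) * Q := by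
    have e1 : p * ‖B‖ ≤ p * ((4 * p + 6) * Q) := by gcongr
    have e2 : p * (p + 1) * ‖C‖ ≤ p * (p + 1) * (2 * Q) := by gcongr
    nlinarith
  have hpQ : 0 ≤ p * Q := by positivity
  have hppQ : 0 ≤ p ^ 2 * Q := by positivity
  refine ⟨?_, ?_, ?_⟩ <;> nlinarith

/-- The constant in the pointwise bounds of `weights_le_of_testFn`. -/
def lowerConst (α : ℝ) : ℝ := 4 * (6 * α ^ 2 + 8 * α + 6) / testConst α

lemma lowerConst_pos {α : ℝ} (hα : 1 < α) : 0 < lowerConst α := by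
  have := testConst_pos hα
  unfold lowerConst
  positivity

lemma weights_le_of_testFn {α X Q : ℝ} (hα : 1 < α) (hX : 0 ≤ X) {U V W a : ℂ}
    (ha : a ∈ unitDisk) (ha2 : 1 / 2 ≤ ‖a‖)
    (h : ∀ k : ℕ, 1 ≤ k → k ≤ 3 → X * ‖U * testFn α k a a + V * deriv (testFn α k a) a
      + W * deriv (deriv (testFn α k a)) a‖ ≤ Q) :
    X * ‖U‖ / (1 - ‖a‖ ^ 2) ^ (α - 1) ≤ lowerConst α * Q ∧
      X * ‖V‖ / (1 - ‖a‖ ^ 2) ^ α ≤ lowerConst α * Q ∧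
      X * ‖W‖ / (1 - ‖a‖ ^ 2) ^ (α + 1) ≤ lowerConst α * Q := by
  have hY := one_sub_normSq_pos ha
  have hc := testConst_pos hα
  set Y := 1 - ‖a‖ ^ 2 with hYdef
  set c := testConst α with hcdef
  have hQ : 0 ≤ Q := le_trans (by positivity) (h 1 le_rfl (by norm_num))
  set A : ℂ := ((X * c / Y ^ (α - 1) : ℝ) : ℂ) * U with hA
  set B : ℂ := ((X * c / Y ^ α : ℝ) : ℂ) * (starRingEnd ℂ a * V) with hB
  set C : ℂ := ((X * c / Y ^ (α + 1) : ℝ) : ℂ) * (starRingEnd ℂ a ^ 2 * W) with hC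
  have e : ∀ (q : ℝ) (k : ℕ), Y ^ k * Y ^ (-(q + k)) = 1 / Y ^ q := by
    intro q k
    rw [← Real.rpow_natCast, ← Real.rpow_add hY, one_div, ← Real.rpow_neg hY.le]
    congr 1
    ring
  have key : ∀ k : ℕ, 1 ≤ k → k ≤ 3 →
      ‖A + ((α - 1 + k : ℝ) : ℂ) * B
        + ((α - 1 + k : ℝ) : ℂ) * ((α - 1 + k + 1 : ℝ) : ℂ) * C‖ ≤ Q := by
    intro k hk hk3
    refine le_trans (le_of_eq ?_) (h k hk hk3)
    rw [deriv_testFn α k ha ha, deriv_deriv_testFn α k ha ha, testFn, kernelPow_self _ ha,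
      kernelPow_self _ ha, kernelPow_self _ ha, ← hYdef, ← hcdef]
    conv_rhs => rw [← Real.norm_of_nonneg hX, ← norm_real X, ← norm_mul]
    congr 1
    have e0 := e (α - 1) k
    have e1 := e α k
    have e2 := e (α + 1) k
    rw [show -(α + k) = -(α - 1 + k + 1) by ring] at e1
    rw [show -(α + 1 + k) = -(α - 1 + k + 1 + 1) by ring] at e2
    have r0 : X * c / Y ^ (α - 1) = X * c * (Y ^ k * Y ^ (-(α - 1 + k))) := by rw [e0]; ring
    have r1 : X * c / Y ^ α = X * c * (Y ^ k * Y ^ (-(α - 1 + k + 1))) := by rw [e1]; ring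
    have r2 : X * c / Y ^ (α + 1) = X * c * (Y ^ k * Y ^ (-(α - 1 + k + 1 + 1))) := by
      rw [e2]; ring
    rw [hA, hB, hC, r0, r1, r2]
    simp only [ofReal_mul]
    ring
  have k1 := key 1 le_rfl (by norm_num)
  have k2 := key 2 (by norm_num) (by norm_num)
  have k3 := key 3 (by norm_num) le_rfl
  obtain ⟨bA, bB, bC⟩ := norm_le_of_quadratic_combinations (p := α) (by linarith)
    (A := A) (B := B) (C := C) (Q := Q)
    (by convert k1 using 2; push_cast; ring) (by convert k2 using 2; push_cast; ring)
    (by convert k3 using 2; push_cast; ring)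
  have hP : 0 ≤ (6 * α ^ 2 + 8 * α + 6) * Q := by positivity
  have nA : ‖A‖ = c * (X * ‖U‖ / Y ^ (α - 1)) := by
    rw [hA, norm_mul, norm_real, Real.norm_of_nonneg (by positivity)]
    ring
  have nB : ‖B‖ = ‖a‖ * (c * (X * ‖V‖ / Y ^ α)) := by
    rw [hB, norm_mul, norm_real, Real.norm_of_nonneg (by positivity), norm_mul, RCLike.norm_conj]
    ring
  have nC : ‖C‖ = ‖a‖ ^ 2 * (c * (X * ‖W‖ / Y ^ (α + 1))) := by
    rw [hC, norm_mul, norm_real, Real.norm_of_nonneg (by positivity), norm_mul, norm_pow,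
      RCLike.norm_conj]
    ring
  have fin : ∀ v : ℝ, c * v ≤ 4 * ((6 * α ^ 2 + 8 * α + 6) * Q) → v ≤ lowerConst α * Q := by
    intro v hv
    rw [lowerConst, ← hcdef, div_mul_eq_mul_div, le_div_iff₀ hc]
    linarith
  have ha4 : 1 / 4 ≤ ‖a‖ ^ 2 := by nlinarith
  refine ⟨fin _ (by linarith), fin _ ?_, fin _ ?_⟩
  · have : 0 ≤ c * (X * ‖V‖ / Y ^ α) := by positivity
    nlinarith
  · have : 0 ≤ c * (X * ‖W‖ / Y ^ (α + 1)) := by positivity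
    nlinarith

lemma phiLimsup_le {φ : ℂ → ℂ} {F : ℂ → ℝ} {s B : ℝ} (hF : ∀ z ∈ unitDisk, 0 ≤ F z)
    (hs : 0 ≤ s) (hs1 : s < 1) (hB : 0 ≤ B) (h : ∀ z ∈ unitDisk, s < ‖φ z‖ → F z ≤ B) :
    phiLimsup φ F ≤ B := by
  have hbdd : BddBelow ((fun s => sSup {y | ∃ z ∈ unitDisk, s < ‖φ z‖ ∧ y = F z}) ''
      Set.Ico (0 : ℝ) 1) := by
    refine ⟨0, ?_⟩
    rintro _ ⟨s, -, rfl⟩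
    refine Real.sSup_nonneg ?_
    rintro _ ⟨z, hz, -, rfl⟩
    exact hF z hz
  refine (csInf_le hbdd ⟨s, ⟨hs, hs1⟩, rfl⟩).trans (Real.sSup_le ?_ hB)
  rintro _ ⟨z, hz, hsz, rfl⟩
  exact h z hz hsz

lemma phiLimsup_nonneg {φ : ℂ → ℂ} {F : ℂ → ℝ} (hF : ∀ z ∈ unitDisk, 0 ≤ F z) :
    0 ≤ phiLimsup φ F := by
  refine Real.sInf_nonneg ?_
  rintro _ ⟨s, -, rfl⟩
  refine Real.sSup_nonneg ?_
  rintro _ ⟨z, hz, -, rfl⟩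
  exact hF z hz

lemma exists_le_phiLimsup_add {φ : ℂ → ℂ} {F : ℂ → ℝ} {B ε : ℝ} (hF : ∀ z ∈ unitDisk, F z ≤ B)
    (hε : 0 < ε) :
    ∃ s : ℝ, s < 1 ∧ ∀ z ∈ unitDisk, s < ‖φ z‖ → F z ≤ phiLimsup φ F + ε := by
  obtain ⟨_, ⟨s, hs, rfl⟩, hlt⟩ := exists_lt_of_csInf_lt
    (s := (fun s => sSup {y | ∃ z ∈ unitDisk, s < ‖φ z‖ ∧ y = F z}) '' Set.Ico (0 : ℝ) 1)
    ((Set.nonempty_Ico.2 one_pos).image _) (lt_add_of_pos_right (phiLimsup φ F) hε)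
  have hbdd : BddAbove {y | ∃ z ∈ unitDisk, s < ‖φ z‖ ∧ y = F z} := by
    refine ⟨B, ?_⟩
    rintro _ ⟨w, hw, -, rfl⟩
    exact hF w hw
  exact ⟨s, hs.2, fun z hz hsz => (le_csSup hbdd ⟨z, hz, hsz, rfl⟩).trans hlt.le⟩

/-- The weight quotient governing `u'' · (f ∘ φ)`. -/
def quotU (α β : ℝ) (u φ : ℂ → ℂ) (z : ℂ) : ℝ :=
  (1 - ‖z‖ ^ 2) ^ β * ‖deriv (deriv u) z‖ / (1 - ‖φ z‖ ^ 2) ^ (α - 1)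

/-- The weight quotient governing `(2u'φ' + uφ'') · (f' ∘ φ)`. -/
def quotV (α β : ℝ) (u φ : ℂ → ℂ) (z : ℂ) : ℝ :=
  (1 - ‖z‖ ^ 2) ^ β * ‖2 * deriv u z * deriv φ z + u z * deriv (deriv φ) z‖ /
    (1 - ‖φ z‖ ^ 2) ^ α

/-- The weight quotient governing `uφ'² · (f'' ∘ φ)`. -/
def quotW (α β : ℝ) (u φ : ℂ → ℂ) (z : ℂ) : ℝ :=
  (1 - ‖z‖ ^ 2) ^ β * (‖u z‖ * ‖deriv φ z‖ ^ 2) / (1 - ‖φ z‖ ^ 2) ^ (α + 1)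

section Quotients

variable {α β : ℝ} {u φ : ℂ → ℂ} {z : ℂ}

lemma quotU_nonneg (hm : Set.MapsTo φ unitDisk unitDisk) (hz : z ∈ unitDisk) :
    0 ≤ quotU α β u φ z :=
  div_nonneg (mul_nonneg (weight_nonneg β hz) (norm_nonneg _)) (weight_nonneg _ (hm hz))

lemma quotV_nonneg (hm : Set.MapsTo φ unitDisk unitDisk) (hz : z ∈ unitDisk) :
    0 ≤ quotV α β u φ z :=
  div_nonneg (mul_nonneg (weight_nonneg β hz) (norm_nonneg _)) (weight_nonneg _ (hm hz))

lemma quotW_nonneg (hm : Set.MapsTo φ unitDisk unitDisk) (hz : z ∈ unitDisk) :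
    0 ≤ quotW α β u φ z :=
  div_nonneg (mul_nonneg (weight_nonneg β hz) (by positivity)) (weight_nonneg _ (hm hz))

lemma MemZygmund.weight_mul_le_zygNorm {f : ℂ → ℂ} (hf : MemZygmund β f) (hz : z ∈ unitDisk) :
    (1 - ‖z‖ ^ 2) ^ β * ‖deriv (deriv f) z‖ ≤ zygNorm β f :=
  (hf.weight_mul_le hz).trans (le_add_of_nonneg_left (by positivity))

lemma BoundedBlochToZygmund.weight_mul_le (hu : DifferentiableOn ℂ u unitDisk)
    (hφ : DifferentiableOn ℂ φ unitDisk) (hm : Set.MapsTo φ unitDisk unitDisk)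
    (hb : BoundedBlochToZygmund α β u φ) {f : ℂ → ℂ} (hf : MemBloch α f) (hz : z ∈ unitDisk) :
    (1 - ‖z‖ ^ 2) ^ β * ‖deriv (deriv u) z * f (φ z)
      + (2 * deriv u z * deriv φ z + u z * deriv (deriv φ) z) * deriv f (φ z)
      + u z * deriv φ z ^ 2 * deriv (deriv f) (φ z)‖ ≤ zygNorm β (wcomp u φ f) := by
  rw [← deriv_deriv_wcomp hu hφ hm hf.1 hz]
  exact (hb.1 f hf).weight_mul_le_zygNorm hz

lemma quot_le_of_testFn (hα : 1 < α) (hu : DifferentiableOn ℂ u unitDisk)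
    (hφ : DifferentiableOn ℂ φ unitDisk) (hm : Set.MapsTo φ unitDisk unitDisk)
    (hb : BoundedBlochToZygmund α β u φ) (hz : z ∈ unitDisk) (hz2 : 1 / 2 ≤ ‖φ z‖) {Q : ℝ}
    (h : ∀ k : ℕ, 1 ≤ k → k ≤ 3 → zygNorm β (wcomp u φ (testFn α k (φ z))) ≤ Q) :
    quotU α β u φ z ≤ lowerConst α * Q ∧ quotV α β u φ z ≤ lowerConst α * Q ∧
      quotW α β u φ z ≤ lowerConst α * Q := by
  have key := weights_le_of_testFn hα (weight_nonneg β hz) (hm hz) hz2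
    (U := deriv (deriv u) z) (V := 2 * deriv u z * deriv φ z + u z * deriv (deriv φ) z)
    (W := u z * deriv φ z ^ 2) (Q := Q) fun k hk hk3 =>
      (hb.weight_mul_le hu hφ hm (memBloch_testFn hα hk hk3 (hm hz)).1 hz).trans (h k hk hk3)
  rwa [norm_mul (u z), norm_pow] at key

lemma memBloch_pow (hα : 1 < α) (n : ℕ) : MemBloch α (fun z => z ^ n) := by
  refine memBloch_of_le (C := n) (by fun_prop) fun z hz => ?_
  have h1 : (1 - ‖z‖ ^ 2) ^ α ≤ 1 :=
    Real.rpow_le_one (one_sub_normSq_pos hz).le (one_sub_normSq_le_one z) (by linarith)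
  have h2 : ‖z‖ ^ (n - 1) ≤ 1 := pow_le_one₀ (norm_nonneg _) (mem_unitDisk.1 hz).le
  have h3 : deriv (fun z : ℂ => z ^ n) z = n * z ^ (n - 1) := by simp
  rw [h3, norm_mul, norm_pow, Complex.norm_natCast]
  calc _ ≤ 1 * (n * (1 : ℝ)) := by
        refine mul_le_mul h1 (by gcongr) (by positivity) zero_le_one
    _ = n := by ring

lemma exists_coeff_bound (hα : 1 < α) (hu : DifferentiableOn ℂ u unitDisk)
    (hφ : DifferentiableOn ℂ φ unitDisk) (hm : Set.MapsTo φ unitDisk unitDisk)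
    (hb : BoundedBlochToZygmund α β u φ) :
    ∃ L : ℝ, 0 ≤ L ∧ ∀ z ∈ unitDisk, (1 - ‖z‖ ^ 2) ^ β * ‖deriv (deriv u) z‖ ≤ L ∧
      (1 - ‖z‖ ^ 2) ^ β * ‖2 * deriv u z * deriv φ z + u z * deriv (deriv φ) z‖ ≤ L ∧
      (1 - ‖z‖ ^ 2) ^ β * (‖u z‖ * ‖deriv φ z‖ ^ 2) ≤ L := by
  set q : ℕ → ℝ := fun n => zygNorm β (wcomp u φ (fun z => z ^ n)) with hq
  have hq0 : ∀ n, 0 ≤ q n := fun n => zygNorm_nonneg _ _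
  refine ⟨q 2 + 3 * q 1 + 3 * q 0, by linarith [hq0 0, hq0 1, hq0 2], fun z hz => ?_⟩
  have key := fun n => hb.weight_mul_le hu hφ hm (memBloch_pow hα n) hz
  have d1 : deriv (fun z : ℂ => z ^ 1) = fun _ => 1 := by ext; simp
  have d2 : deriv (fun z : ℂ => z ^ 2) = fun z => 2 * z := by ext; simp
  have d2' : deriv (fun z : ℂ => 2 * z) = fun _ => 2 := by
    ext; simp
  have k0 := key 0
  have k1 := key 1
  have k2 := key 2
  have hw := weight_nonneg β hz
  have hφz := (mem_unitDisk.1 (hm hz)).le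
  rw [d1] at k1
  rw [d2, d2'] at k2
  simp only [pow_zero, deriv_const', mul_one, mul_zero, add_zero, pow_one] at k0 k1 k2
  set X := (1 - ‖z‖ ^ 2) ^ β
  set U := deriv (deriv u) z
  set V := 2 * deriv u z * deriv φ z + u z * deriv (deriv φ) z
  set p := φ z
  have hW : ‖u z‖ * ‖deriv φ z‖ ^ 2 = ‖u z * deriv φ z ^ 2‖ := by rw [norm_mul, norm_pow]
  rw [hW]
  set W := u z * deriv φ z ^ 2
  have e0 : X * ‖U‖ ≤ q 0 := by simpa [hq] using k0
  have e1 : X * ‖U * p + V‖ ≤ q 1 := by simpa [hq] using k1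
  have e2 : X * ‖U * p ^ 2 + V * (2 * p) + W * 2‖ ≤ q 2 := k2
  have f1 : ‖V‖ ≤ ‖U * p + V‖ + ‖U‖ := by
    have := norm_sub_le (U * p + V) (U * p)
    rw [add_sub_cancel_left, norm_mul] at this
    nlinarith [norm_nonneg U]
  have f2 : 2 * ‖W‖ ≤ ‖U * p ^ 2 + V * (2 * p) + W * 2‖ + ‖U‖ + 2 * ‖V‖ := by
    have a1 := norm_sub_le (U * p ^ 2 + V * (2 * p) + W * 2) (U * p ^ 2 + V * (2 * p))
    have a2 := norm_add_le (U * p ^ 2) (V * (2 * p))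
    simp only [add_sub_cancel_left, norm_mul, norm_pow, Complex.norm_two] at a1 a2
    have b1 : ‖U‖ * ‖p‖ ^ 2 ≤ ‖U‖ :=
      mul_le_of_le_one_right (norm_nonneg _) (pow_le_one₀ (norm_nonneg _) hφz)
    have b2 : ‖V‖ * (2 * ‖p‖) ≤ 2 * ‖V‖ := by nlinarith [norm_nonneg V]
    linarith
  have g1 : X * ‖V‖ ≤ q 1 + q 0 := by
    have := mul_le_mul_of_nonneg_left f1 hw
    rw [mul_add] at this
    linarith
  have g2 : 2 * (X * ‖W‖) ≤ q 2 + q 0 + 2 * (q 1 + q 0) := by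
    have := mul_le_mul_of_nonneg_left f2 hw
    nlinarith
  have := hq0 0
  have := hq0 1
  have := hq0 2
  exact ⟨by linarith, by linarith, by linarith⟩

lemma exists_quot_bound (hα : 1 < α) (hu : DifferentiableOn ℂ u unitDisk)
    (hφ : DifferentiableOn ℂ φ unitDisk) (hm : Set.MapsTo φ unitDisk unitDisk)
    (hb : BoundedBlochToZygmund α β u φ) :
    ∃ B : ℝ, ∀ z ∈ unitDisk, quotU α β u φ z ≤ B ∧ quotV α β u φ z ≤ B ∧ quotW α β u φ z ≤ B := by
  obtain ⟨L, hL, hcoef⟩ := exists_coeff_bound hα hu hφ hm hb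
  obtain ⟨C, hC, hbd⟩ := hb.2
  have hD := lowerConst_pos hα
  refine ⟨max (lowerConst α * C) (L / (1 / 4) ^ (α + 1)), fun z hz => ?_⟩
  rcases le_or_gt (1 / 2) ‖φ z‖ with h | h
  · obtain ⟨h1, h2, h3⟩ := quot_le_of_testFn hα hu hφ hm hb hz h (Q := C) fun k hk hk3 => by
      obtain ⟨t1, t2⟩ := memBloch_testFn hα hk hk3 (hm hz)
      exact (hbd _ t1).trans (mul_le_of_le_one_right hC.le t2)
    exact ⟨h1.trans (le_max_left _ _), h2.trans (le_max_left _ _), h3.trans (le_max_left _ _)⟩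
  · obtain ⟨h1, h2, h3⟩ := hcoef z hz
    have hY : 1 / 4 ≤ 1 - ‖φ z‖ ^ 2 := by nlinarith [norm_nonneg (φ z)]
    have key : ∀ v γ : ℝ, 0 ≤ γ → γ ≤ α + 1 → v ≤ L →
        v / (1 - ‖φ z‖ ^ 2) ^ γ ≤ max (lowerConst α * C) (L / (1 / 4) ^ (α + 1)) := by
      intro v γ hγ hγα hv
      refine le_trans ?_ (le_max_right _ _)
      have : ((1 : ℝ) / 4) ^ (α + 1) ≤ (1 - ‖φ z‖ ^ 2) ^ γ :=
        (Real.rpow_le_rpow_of_exponent_ge (by norm_num) (by norm_num) hγα).trans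
          (Real.rpow_le_rpow (by norm_num) hY hγ)
      exact div_le_div₀ hL hv (by positivity) this
    exact ⟨key _ _ (by linarith) (by linarith) h1, key _ _ (by linarith) (by linarith) h2,
      key _ _ (by linarith) le_rfl h3⟩

lemma bddAbove_zygNorm_sub {K : (ℂ → ℂ) → ℂ → ℂ} (hb : BoundedBlochToZygmund α β u φ)
    (hK : IsCompactOpToZygmund α β (MemBloch α) K) :
    BddAbove {s | ∃ f, MemBloch α f ∧ blochNorm α f ≤ 1 ∧
          s = zygNorm β (fun z => wcomp u φ f z - K f z)} := by
  obtain ⟨C, hC, hbd⟩ := hb.2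
  obtain ⟨C', hC'⟩ := hK.2.2.1
  refine ⟨C + |C'|, ?_⟩
  rintro _ ⟨f, hf, hf1, rfl⟩
  have h1 := zygNorm_sub_le (hb.1 f hf) (hK.2.1 f hf)
  have h2 := hbd f hf
  have h3 := hC' f hf
  have h4 := blochNorm_nonneg α f
  have h5 : C * blochNorm α f ≤ C := mul_le_of_le_one_right hC.le hf1
  have h6 : C' * blochNorm α f ≤ |C'| := by nlinarith [le_abs_self C', abs_nonneg C']
  linarith

lemma phiLimsup_quot_le (hα : 1 < α) (hu : DifferentiableOn ℂ u unitDisk)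
    (hφ : DifferentiableOn ℂ φ unitDisk) (hm : Set.MapsTo φ unitDisk unitDisk)
    (hb : BoundedBlochToZygmund α β u φ) {K : (ℂ → ℂ) → ℂ → ℂ}
    (hK : IsCompactOpToZygmund α β (MemBloch α) K) :
    max (phiLimsup φ (quotU α β u φ)) (max (phiLimsup φ (quotV α β u φ))
      (phiLimsup φ (quotW α β u φ))) ≤ lowerConst α *
        sSup {s | ∃ f, MemBloch α f ∧ blochNorm α f ≤ 1 ∧
          s = zygNorm β (fun z => wcomp u φ f z - K f z)} := by
  have hD := lowerConst_pos hα
  set r := sSup {s | ∃ f, MemBloch α f ∧ blochNorm α f ≤ 1 ∧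
          s = zygNorm β (fun z => wcomp u φ f z - K f z)} with hr
  have hr0 : 0 ≤ r := by
    refine Real.sSup_nonneg ?_
    rintro _ ⟨f, -, -, rfl⟩
    exact zygNorm_nonneg _ _
  refine le_of_forall_pos_le_add fun ε hε => ?_
  set δ := ε / lowerConst α with hδ
  have hδ0 : 0 < δ := div_pos hε hD
  have hex : ∀ k : ℕ, 1 ≤ k → k ≤ 3 → ∃ s : ℝ, s < 1 ∧
      ∀ a ∈ unitDisk, s < ‖a‖ → zygNorm β (K (testFn α k a)) ≤ δ := fun k hk hk3 =>
    hK.exists_zygNorm_le (fun a ha => (memBloch_testFn hα hk hk3 ha).1)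
      (fun a ha => (memBloch_testFn hα hk hk3 ha).2) (fun a ha => norm_testFn_zero_le hα hk ha)
      (fun a ha z hz => weight_mul_deriv_testFn_le hα hk hk3 ha hz) hδ0
  obtain ⟨s1, hs1, H1⟩ := hex 1 le_rfl (by norm_num)
  obtain ⟨s2, hs2, H2⟩ := hex 2 (by norm_num) (by norm_num)
  obtain ⟨s3, hs3, H3⟩ := hex 3 (by norm_num) le_rfl
  set s := max (1 / 2) (max s1 (max s2 s3)) with hs
  have hs_lt : s < 1 := by
    rw [hs]
    simp only [max_lt_iff]
    exact ⟨by norm_num, hs1, hs2, hs3⟩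
  have key : ∀ z ∈ unitDisk, s < ‖φ z‖ → quotU α β u φ z ≤ lowerConst α * r + ε ∧
      quotV α β u φ z ≤ lowerConst α * r + ε ∧ quotW α β u φ z ≤ lowerConst α * r + ε := by
    intro z hz hsz
    rw [hs] at hsz
    simp only [max_lt_iff] at hsz
    have hQ : lowerConst α * r + ε = lowerConst α * (r + δ) := by
      rw [hδ]
      field_simp
    rw [hQ]
    refine quot_le_of_testFn hα hu hφ hm hb hz hsz.1.le fun k hk hk3 => ?_
    obtain ⟨t1, t2⟩ := memBloch_testFn hα hk hk3 (hm hz)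
    have h1 := zygNorm_le_sub_add (hb.1 _ t1) (hK.2.1 _ t1)
    have h2 : zygNorm β (fun w => wcomp u φ (testFn α k (φ z)) w - K (testFn α k (φ z)) w) ≤ r :=
      le_csSup (bddAbove_zygNorm_sub hb hK) ⟨_, t1, t2, rfl⟩
    have h3 : zygNorm β (K (testFn α k (φ z))) ≤ δ := by
      interval_cases k
      · exact H1 _ (hm hz) hsz.2.1
      · exact H2 _ (hm hz) hsz.2.2.1
      · exact H3 _ (hm hz) hsz.2.2.2
    linarith
  have hs0 : 0 ≤ s := le_trans (by norm_num) (le_max_left _ _)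
  have hB : 0 ≤ lowerConst α * r + ε := by positivity
  refine max_le ?_ (max_le ?_ ?_)
  · exact phiLimsup_le (fun z hz => quotU_nonneg hm hz) hs0 hs_lt hB fun z hz h => (key z hz h).1
  · exact phiLimsup_le (fun z hz => quotV_nonneg hm hz) hs0 hs_lt hB fun z hz h => (key z hz h).2.1
  · exact phiLimsup_le (fun z hz => quotW_nonneg hm hz) hs0 hs_lt hB fun z hz h => (key z hz h).2.2

end Quotients

lemma norm_deriv_le_of_growth {g : ℂ → ℂ} (hg : DifferentiableOn ℂ g unitDisk) {γ G : ℝ}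
    (hγ : 0 ≤ γ) (hG : 0 ≤ G) (h : ∀ w ∈ unitDisk, ‖g w‖ ≤ G * (1 - ‖w‖ ^ 2) ^ (-γ))
    {w : ℂ} (hw : w ∈ unitDisk) :
    ‖deriv g w‖ ≤ G * 4 ^ (γ + 1) * (1 - ‖w‖ ^ 2) ^ (-(γ + 1)) := by
  have hw1 := mem_unitDisk.1 hw
  have hw0 := norm_nonneg w
  have hY := one_sub_normSq_pos hw
  set Y := 1 - ‖w‖ ^ 2 with hYd
  set R := (1 - ‖w‖) / 2 with hR
  have hRpos : 0 < R := by rw [hR]; linarith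
  have hmem : ∀ ξ ∈ Metric.closedBall w R, ‖ξ‖ ≤ ‖w‖ + R := by
    intro ξ hξ
    have h1 := norm_add_le (ξ - w) w
    rw [sub_add_cancel] at h1
    rw [mem_closedBall_iff_norm] at hξ
    linarith
  have hsub : Metric.closedBall w R ⊆ unitDisk := by
    intro ξ hξ
    rw [mem_unitDisk]
    have := hmem ξ hξ
    linarith
  have hb : ∀ ξ ∈ Metric.sphere w R, ‖g ξ‖ ≤ G * (Y / 4) ^ (-γ) := by
    intro ξ hξ
    have hξ' := Metric.sphere_subset_closedBall hξ
    refine (h ξ (hsub hξ')).trans ?_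
    have h1 := hmem ξ hξ'
    have h2 : Y / 4 ≤ 1 - ‖ξ‖ ^ 2 := by
      have := norm_nonneg ξ
      nlinarith
    exact mul_le_mul_of_nonneg_left
      (Real.rpow_le_rpow_of_nonpos (by positivity) h2 (by linarith)) hG
  have hd : DiffContOnCl ℂ g (Metric.ball w R) := by
    apply DifferentiableOn.diffContOnCl
    rw [closure_ball w hRpos.ne']
    exact hg.mono hsub
  have key := Complex.norm_deriv_le_of_forall_mem_sphere_norm_le hRpos hd hb
  refine key.trans ?_
  have hRY : Y / 4 ≤ R := by rw [hYd, hR]; nlinarith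
  calc G * (Y / 4) ^ (-γ) / R ≤ G * (Y / 4) ^ (-γ) / (Y / 4) := by gcongr
    _ = G * (Y / 4) ^ (-(γ + 1)) := by
        rw [show -(γ + 1) = -γ - 1 by ring, Real.rpow_sub_one (by positivity)]
        ring
    _ = _ := by
        rw [Real.div_rpow hY.le (by norm_num), Real.rpow_neg (by norm_num : (0 : ℝ) ≤ 4) (γ + 1)]
        field_simp

lemma norm_le_of_norm_deriv_le {f : ℂ → ℂ} {α : ℝ} (hα : 1 < α)
    (hf : DifferentiableOn ℂ f unitDisk) (hf0 : ‖f 0‖ ≤ 1)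
    (h : ∀ w ∈ unitDisk, ‖deriv f w‖ ≤ (1 - ‖w‖ ^ 2) ^ (-α)) {w : ℂ} (hw : w ∈ unitDisk) :
    ‖f w‖ ≤ (1 + 2 ^ (α - 1) / (α - 1)) * (1 - ‖w‖ ^ 2) ^ (-(α - 1)) := by
  have hw1 := mem_unitDisk.1 hw
  have hw0 := norm_nonneg w
  have hα1 : 0 < α - 1 := by linarith
  have hpos : ∀ t ∈ Set.Icc (0 : ℝ) 1, 0 < 1 - t * ‖w‖ := fun t ht => by nlinarith [ht.1, ht.2]
  have hmem : ∀ t ∈ Set.Icc (0 : ℝ) 1, (t : ℂ) * w ∈ unitDisk := fun t ht => by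
    rw [mem_unitDisk, norm_mul, norm_real, Real.norm_of_nonneg ht.1]
    nlinarith [ht.1, ht.2]
  have hF : ∀ t ∈ Set.Icc (0 : ℝ) 1,
      HasDerivAt (fun t : ℝ => f (t * w)) (deriv f (t * w) * w) t := by
    intro t ht
    have h1 : HasDerivAt (fun t : ℂ => t * w) w (t : ℂ) := by
      simpa using (hasDerivAt_id (t : ℂ)).mul_const w
    exact ((differentiableAt_of_disk hf (hmem t ht)).hasDerivAt.comp (t : ℂ) h1).comp_ofReal
  have hB : ∀ t ∈ Set.Icc (0 : ℝ) 1,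
      HasDerivAt (fun t : ℝ => 1 + (1 - t * ‖w‖) ^ (-(α - 1)) / (α - 1))
        (‖w‖ * (1 - t * ‖w‖) ^ (-α)) t := by
    intro t ht
    have h1 : HasDerivAt (fun t : ℝ => 1 - t * ‖w‖) (-‖w‖) t := by
      simpa using ((hasDerivAt_id t).mul_const ‖w‖).const_sub 1
    have h2 := h1.rpow_const (p := -(α - 1)) (Or.inl (hpos t ht).ne')
    refine ((h2.div_const (α - 1)).const_add 1).congr_deriv ?_
    rw [show -(α - 1) - 1 = -α by ring]
    field_simp
  have key := image_norm_le_of_norm_deriv_right_le_deriv_boundary'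
    (f := fun t : ℝ => f (t * w)) (f' := fun t => deriv f (t * w) * w) (a := 0) (b := 1)
    (fun t ht => (hF t ht).continuousAt.continuousWithinAt)
    (fun t ht => (hF t ⟨ht.1, ht.2.le⟩).hasDerivWithinAt)
    (B := fun t : ℝ => 1 + (1 - t * ‖w‖) ^ (-(α - 1)) / (α - 1))
    (B' := fun t => ‖w‖ * (1 - t * ‖w‖) ^ (-α))
    (by
      have : 0 ≤ 1 / (α - 1) := by positivity
      simp only [ofReal_zero, zero_mul, sub_zero, Real.one_rpow]
      linarith)
    (fun t ht => (hB t ht).continuousAt.continuousWithinAt)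
    (fun t ht => (hB t ⟨ht.1, ht.2.le⟩).hasDerivWithinAt)
    (fun t ht => by
      have ht' : t ∈ Set.Icc (0 : ℝ) 1 := ⟨ht.1, ht.2.le⟩
      have h1 := h _ (hmem t ht')
      have h2 : 1 - t * ‖w‖ ≤ 1 - ‖(t : ℂ) * w‖ ^ 2 := by
        rw [norm_mul, norm_real, Real.norm_of_nonneg ht.1]
        nlinarith [hpos t ht', mul_nonneg ht.1 hw0]
      have h3 := Real.rpow_le_rpow_of_nonpos (hpos t ht') h2 (by linarith : -α ≤ 0)
      rw [norm_mul, mul_comm]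
      exact mul_le_mul_of_nonneg_left (h1.trans h3) hw0)
    (x := 1) ⟨zero_le_one, le_rfl⟩
  simp only [ofReal_one, one_mul] at key
  have hY := one_sub_normSq_pos hw
  have e1 : (1 - ‖w‖) ^ (-(α - 1)) ≤ 2 ^ (α - 1) * (1 - ‖w‖ ^ 2) ^ (-(α - 1)) := by
    have : (1 - ‖w‖ ^ 2) / 2 ≤ 1 - ‖w‖ := by nlinarith
    refine (Real.rpow_le_rpow_of_nonpos (by positivity) this (by linarith)).trans_eq ?_
    rw [Real.div_rpow hY.le zero_le_two, Real.rpow_neg zero_le_two]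
    field_simp
  have e2 : 1 ≤ (1 - ‖w‖ ^ 2) ^ (-(α - 1)) :=
    Real.one_le_rpow_of_pos_of_le_one_of_nonpos hY (one_sub_normSq_le_one w) (by linarith)
  calc ‖f w‖ ≤ 1 + (1 - ‖w‖) ^ (-(α - 1)) / (α - 1) := key
    _ ≤ (1 - ‖w‖ ^ 2) ^ (-(α - 1)) + 2 ^ (α - 1) * (1 - ‖w‖ ^ 2) ^ (-(α - 1)) / (α - 1) := by
        gcongr
    _ = _ := by ring

lemma MemBloch.norm_deriv_le {α : ℝ} {f : ℂ → ℂ} (hf : MemBloch α f) (hf1 : blochNorm α f ≤ 1)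
    {w : ℂ} (hw : w ∈ unitDisk) : ‖deriv f w‖ ≤ (1 - ‖w‖ ^ 2) ^ (-α) := by
  have hY := one_sub_normSq_pos hw
  have h := (hf.weight_mul_le hw).trans hf1
  rw [Real.rpow_neg hY.le, ← one_div, le_div_iff₀ (by positivity)]
  linarith

lemma exists_growth_const {α : ℝ} (hα : 1 < α) :
    ∃ G : ℝ, 1 ≤ G ∧ ∀ f, MemBloch α f → blochNorm α f ≤ 1 → ∀ w ∈ unitDisk,
      ‖f w‖ ≤ G * (1 - ‖w‖ ^ 2) ^ (-(α - 1)) ∧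
      ‖deriv f w‖ ≤ G * (1 - ‖w‖ ^ 2) ^ (-α) ∧
      ‖deriv (deriv f) w‖ ≤ G * (1 - ‖w‖ ^ 2) ^ (-(α + 1)) ∧
      ‖deriv (deriv (deriv f)) w‖ ≤ G * (1 - ‖w‖ ^ 2) ^ (-(α + 2)) := by
  set G0 : ℝ := 1 + 2 ^ (α - 1) / (α - 1)
  set G2 : ℝ := 1 * 4 ^ (α + 1)
  set G3 : ℝ := G2 * 4 ^ (α + 1 + 1)
  have hα1 : 0 < α - 1 := by linarith
  have hG0 : 1 ≤ G0 := le_add_of_nonneg_right (by positivity)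
  have hG2 : 0 ≤ G2 := by positivity
  have hG3 : 0 ≤ G3 := by positivity
  refine ⟨G0 + G2 + G3, by linarith, fun f hf hf1 w hw => ?_⟩
  have b0 : ‖f 0‖ ≤ 1 := le_trans (le_add_of_nonneg_right (wnorm_nonneg _ _)) hf1
  have d1 : ∀ w ∈ unitDisk, ‖deriv f w‖ ≤ 1 * (1 - ‖w‖ ^ 2) ^ (-α) := fun w hw => by
    rw [one_mul]
    exact hf.norm_deriv_le hf1 hw
  have hf' := hf.1.deriv isOpen_unitDisk
  have d2 : ∀ w ∈ unitDisk, ‖deriv (deriv f) w‖ ≤ G2 * (1 - ‖w‖ ^ 2) ^ (-(α + 1)) :=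
    fun w hw => norm_deriv_le_of_growth hf' (by linarith) zero_le_one d1 hw
  have d3 : ‖deriv (deriv (deriv f)) w‖ ≤ G3 * (1 - ‖w‖ ^ 2) ^ (-(α + 1 + 1)) :=
    norm_deriv_le_of_growth (hf'.deriv isOpen_unitDisk) (by linarith) hG2 d2 hw
  rw [show -(α + 1 + 1) = -(α + 2) by ring] at d3
  have d0 := norm_le_of_norm_deriv_le hα hf.1 b0 (fun w hw => hf.norm_deriv_le hf1 hw) hw
  refine ⟨d0.trans ?_, (d1 w hw).trans ?_, (d2 w hw).trans ?_, d3.trans ?_⟩ <;>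
    refine mul_le_mul_of_nonneg_right ?_ (weight_nonneg _ hw) <;> linarith

lemma exists_uniform_bound {α : ℝ} (hα : 1 < α) {s : ℝ} (hs0 : 0 ≤ s) (hs : s < 1) :
    ∃ M : ℝ, 0 < M ∧ ∀ f, MemBloch α f → blochNorm α f ≤ 1 → ∀ w : ℂ, ‖w‖ ≤ s →
      ‖f w‖ ≤ M ∧ ‖deriv f w‖ ≤ M ∧ ‖deriv (deriv f) w‖ ≤ M ∧
        ‖deriv (deriv (deriv f)) w‖ ≤ M := by
  obtain ⟨G, hG, hgr⟩ := exists_growth_const hα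
  have hs2 : 0 < 1 - s ^ 2 := by nlinarith
  refine ⟨G * (1 - s ^ 2) ^ (-(α + 2)), by positivity, fun f hf hf1 w hw => ?_⟩
  have hwd : w ∈ unitDisk := mem_unitDisk.2 (hw.trans_lt hs)
  obtain ⟨h0, h1, h2, h3⟩ := hgr f hf hf1 w hwd
  have hY : 1 - s ^ 2 ≤ 1 - ‖w‖ ^ 2 := by
    have := norm_nonneg w
    nlinarith
  have key : ∀ γ : ℝ, 0 ≤ γ → γ ≤ α + 2 →
      G * (1 - ‖w‖ ^ 2) ^ (-γ) ≤ G * (1 - s ^ 2) ^ (-(α + 2)) := by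
    intro γ h0 hγ
    refine mul_le_mul_of_nonneg_left ?_ (by linarith)
    exact (Real.rpow_le_rpow_of_nonpos hs2 hY (by linarith)).trans
      (Real.rpow_le_rpow_of_exponent_ge hs2 (by nlinarith) (by linarith))
  exact ⟨h0.trans (key _ (by linarith) (by linarith)), h1.trans (key _ (by linarith) (by linarith)),
    h2.trans (key _ (by linarith) (by linarith)), h3.trans (key _ (by linarith) le_rfl)⟩

section Dilation

variable {α r : ℝ} {f g : ℂ → ℂ}

lemma mul_mem_unitDisk (hr0 : 0 ≤ r) (hr1 : r ≤ 1) {z : ℂ} (hz : z ∈ unitDisk) :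
    (r : ℂ) * z ∈ unitDisk := by
  rw [mem_unitDisk, norm_mul, norm_real, Real.norm_of_nonneg hr0]
  have := mem_unitDisk.1 hz
  nlinarith [norm_nonneg z]

lemma norm_mul_le_of_le_one (hr0 : 0 ≤ r) (hr1 : r ≤ 1) (z : ℂ) : ‖(r : ℂ) * z‖ ≤ ‖z‖ := by
  rw [norm_mul, norm_real, Real.norm_of_nonneg hr0]
  exact mul_le_of_le_one_left (norm_nonneg z) hr1

lemma deriv_dilation (f : ℂ → ℂ) (r : ℝ) :
    deriv (fun z => f (r * z)) = fun z => r * deriv f (r * z) := by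
  ext z
  rw [deriv_comp_mul_left, smul_eq_mul]

lemma deriv_deriv_dilation (f : ℂ → ℂ) (r : ℝ) :
    deriv (deriv fun z => f (r * z)) = fun z => (r : ℂ) ^ 2 * deriv (deriv f) (r * z) := by
  ext z
  rw [deriv_dilation, deriv_const_mul_field, deriv_dilation]
  ring

lemma differentiableOn_dilation (hr0 : 0 ≤ r) (hr1 : r ≤ 1) (hf : DifferentiableOn ℂ f unitDisk) :
    DifferentiableOn ℂ (fun z => f (r * z)) unitDisk :=
  hf.comp (by fun_prop) fun _ hz => mul_mem_unitDisk hr0 hr1 hz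

lemma weight_mul_deriv_dilation_le (hα : 1 < α) (hr0 : 0 ≤ r) (hr1 : r ≤ 1)
    (hf : MemBloch α f) {z : ℂ} (hz : z ∈ unitDisk) :
    (1 - ‖z‖ ^ 2) ^ α * ‖deriv (fun z => f (r * z)) z‖ ≤ wnorm α (deriv f) := by
  have hrz := mul_mem_unitDisk hr0 hr1 hz
  have h1 : (1 - ‖(r : ℂ) * z‖ ^ 2) ^ α * ‖deriv f (r * z)‖ ≤ wnorm α (deriv f) :=
    le_csSup hf.2 ⟨_, hrz, rfl⟩
  have h2 := norm_mul_le_of_le_one hr0 hr1 z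
  have h3 : (1 - ‖z‖ ^ 2) ^ α ≤ (1 - ‖(r : ℂ) * z‖ ^ 2) ^ α :=
    Real.rpow_le_rpow (one_sub_normSq_pos hz).le (by gcongr) (by linarith)
  rw [deriv_dilation, norm_mul, norm_real, Real.norm_of_nonneg hr0]
  refine le_trans ?_ h1
  exact mul_le_mul h3 (mul_le_of_le_one_left (norm_nonneg _) hr1) (by positivity)
    (weight_nonneg α hrz)

lemma MemBloch.dilation (hα : 1 < α) (hr0 : 0 ≤ r) (hr1 : r ≤ 1) (hf : MemBloch α f) :
    MemBloch α (fun z => f (r * z)) :=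
  memBloch_of_le (differentiableOn_dilation hr0 hr1 hf.1) fun _ hz =>
    weight_mul_deriv_dilation_le hα hr0 hr1 hf hz

lemma MemBloch.blochNorm_dilation_le (hα : 1 < α) (hr0 : 0 ≤ r) (hr1 : r ≤ 1)
    (hf : MemBloch α f) : blochNorm α (fun z => f (r * z)) ≤ blochNorm α f := by
  have := wnorm_le (wnorm_nonneg _ _) fun z hz => weight_mul_deriv_dilation_le hα hr0 hr1 hf hz
  simp only [blochNorm, mul_zero]
  linarith

lemma MemBloch.sub (hf : MemBloch α f) (hg : MemBloch α g) :
    MemBloch α (fun z => f z - g z) := by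
  simpa [sub_eq_add_neg] using hf.linComb hg 1 (-1)

lemma norm_sub_dilation_le (hr0 : 0 ≤ r) (hr1 : r ≤ 1) {s M : ℝ} (hs : s < 1)
    (hf : DifferentiableOn ℂ f unitDisk) (h : ∀ w : ℂ, ‖w‖ ≤ s → ‖deriv f w‖ ≤ M)
    {w : ℂ} (hw : ‖w‖ ≤ s) : ‖f w - f (r * w)‖ ≤ M * (1 - r) := by
  have hM : 0 ≤ M := (norm_nonneg _).trans (h w hw)
  have hrw := (norm_mul_le_of_le_one hr0 hr1 w).trans hw
  have key := Convex.norm_image_sub_le_of_norm_deriv_le (f := f)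
    (s := Metric.closedBall (0 : ℂ) s) (x := r * w) (y := w) (C := M)
    (fun x hx => differentiableAt_of_disk hf
      (mem_unitDisk.2 ((mem_closedBall_zero_iff.1 hx).trans_lt hs)))
    (fun x hx => h x (mem_closedBall_zero_iff.1 hx)) (convex_closedBall 0 s)
    (mem_closedBall_zero_iff.2 hrw) (mem_closedBall_zero_iff.2 hw)
  refine key.trans (mul_le_mul_of_nonneg_left ?_ hM)
  have e : w - r * w = ((1 - r : ℝ) : ℂ) * w := by push_cast; ring
  rw [e, norm_mul, norm_real, Real.norm_of_nonneg (by linarith)]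
  exact mul_le_of_le_one_right (by linarith) (hw.trans hs.le)

lemma deriv_sub_dilation (hr0 : 0 ≤ r) (hr1 : r ≤ 1) (hf : DifferentiableOn ℂ f unitDisk)
    {z : ℂ} (hz : z ∈ unitDisk) :
    deriv (fun z => f z - f (r * z)) z = deriv f z - r * deriv f (r * z) := by
  rw [deriv_fun_sub (differentiableAt_of_disk hf hz)
    (differentiableAt_of_disk (differentiableOn_dilation hr0 hr1 hf) hz), deriv_dilation]

lemma deriv_deriv_sub_dilation (hr0 : 0 ≤ r) (hr1 : r ≤ 1) (hf : DifferentiableOn ℂ f unitDisk)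
    {z : ℂ} (hz : z ∈ unitDisk) :
    deriv (deriv fun z => f z - f (r * z)) z
      = deriv (deriv f) z - (r : ℂ) ^ 2 * deriv (deriv f) (r * z) := by
  have h := deriv_deriv_linComb hf (differentiableOn_dilation hr0 hr1 hf) 1 (-1) hz
  rw [deriv_deriv_dilation] at h
  simpa [sub_eq_add_neg] using h

/-- On a smaller disk, dilations are uniformly close to the identity up to second order. -/
lemma sub_dilation_near (hr0 : 0 ≤ r) (hr1 : r ≤ 1) {s M : ℝ} (hs : s < 1)
    (hf : DifferentiableOn ℂ f unitDisk) (h : ∀ w : ℂ, ‖w‖ ≤ s → ‖f w‖ ≤ M ∧ ‖deriv f w‖ ≤ M ∧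
      ‖deriv (deriv f) w‖ ≤ M ∧ ‖deriv (deriv (deriv f)) w‖ ≤ M) {w : ℂ} (hw : ‖w‖ ≤ s) :
    ‖f w - f (r * w)‖ ≤ 3 * M * (1 - r) ∧
      ‖deriv (fun z => f z - f (r * z)) w‖ ≤ 3 * M * (1 - r) ∧
      ‖deriv (deriv fun z => f z - f (r * z)) w‖ ≤ 3 * M * (1 - r) := by
  have hM : 0 ≤ M := (norm_nonneg _).trans (h w hw).1
  have hMr : 0 ≤ M * (1 - r) := mul_nonneg hM (by linarith)
  have hrw := (norm_mul_le_of_le_one hr0 hr1 w).trans hw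
  have hwd := mem_unitDisk.2 (hw.trans_lt hs)
  have hf' := hf.deriv isOpen_unitDisk
  have h0 := norm_sub_dilation_le hr0 hr1 hs hf (fun w hw => (h w hw).2.1) hw
  have h1 := norm_sub_dilation_le hr0 hr1 hs hf' (fun w hw => (h w hw).2.2.1) hw
  have h2 := norm_sub_dilation_le hr0 hr1 hs (hf'.deriv isOpen_unitDisk)
    (fun w hw => (h w hw).2.2.2) hw
  obtain ⟨-, b1, b2, -⟩ := h _ hrw
  refine ⟨by linarith, ?_, ?_⟩
  · rw [deriv_sub_dilation hr0 hr1 hf hwd]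
    have e : deriv f w - r * deriv f (r * w)
        = (deriv f w - deriv f (r * w)) + ((1 - r : ℝ) : ℂ) * deriv f (r * w) := by
      push_cast; ring
    have a1 := norm_add_le (deriv f w - deriv f (r * w)) (((1 - r : ℝ) : ℂ) * deriv f (r * w))
    rw [norm_mul, norm_real, Real.norm_of_nonneg (by linarith : 0 ≤ 1 - r)] at a1
    rw [e]
    nlinarith
  · rw [deriv_deriv_sub_dilation hr0 hr1 hf hwd]
    have e : deriv (deriv f) w - (r : ℂ) ^ 2 * deriv (deriv f) (r * w)
        = (deriv (deriv f) w - deriv (deriv f) (r * w))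
          + ((1 - r ^ 2 : ℝ) : ℂ) * deriv (deriv f) (r * w) := by
      push_cast; ring
    have a1 := norm_add_le (deriv (deriv f) w - deriv (deriv f) (r * w))
      (((1 - r ^ 2 : ℝ) : ℂ) * deriv (deriv f) (r * w))
    rw [norm_mul, norm_real, Real.norm_of_nonneg (by nlinarith : 0 ≤ 1 - r ^ 2)] at a1
    rw [e]
    have a2 : (1 - r ^ 2) * ‖deriv (deriv f) (r * w)‖ ≤ 2 * (1 - r) * M :=
      mul_le_mul (by nlinarith) b2 (norm_nonneg _) (by linarith)
    linarith

lemma sub_dilation_far (hr0 : 0 ≤ r) (hr1 : r ≤ 1) (hα : 1 < α) {G : ℝ} (hG : 0 ≤ G)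
    (hf : DifferentiableOn ℂ f unitDisk) (h : ∀ w ∈ unitDisk,
      ‖f w‖ ≤ G * (1 - ‖w‖ ^ 2) ^ (-(α - 1)) ∧ ‖deriv f w‖ ≤ G * (1 - ‖w‖ ^ 2) ^ (-α) ∧
      ‖deriv (deriv f) w‖ ≤ G * (1 - ‖w‖ ^ 2) ^ (-(α + 1))) {w : ℂ} (hw : w ∈ unitDisk) :
    ‖f w - f (r * w)‖ ≤ 2 * G * (1 - ‖w‖ ^ 2) ^ (-(α - 1)) ∧
      ‖deriv (fun z => f z - f (r * z)) w‖ ≤ 2 * G * (1 - ‖w‖ ^ 2) ^ (-α) ∧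
      ‖deriv (deriv fun z => f z - f (r * z)) w‖ ≤ 2 * G * (1 - ‖w‖ ^ 2) ^ (-(α + 1)) := by
  have hrw := mul_mem_unitDisk hr0 hr1 hw
  obtain ⟨a0, a1, a2⟩ := h w hw
  obtain ⟨b0, b1, b2⟩ := h _ hrw
  have hY : 1 - ‖w‖ ^ 2 ≤ 1 - ‖(r : ℂ) * w‖ ^ 2 := by
    have := norm_mul_le_of_le_one hr0 hr1 w
    gcongr
  have key : ∀ γ : ℝ, 0 ≤ γ →
      G * (1 - ‖(r : ℂ) * w‖ ^ 2) ^ (-γ) ≤ G * (1 - ‖w‖ ^ 2) ^ (-γ) := fun γ hγ =>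
    mul_le_mul_of_nonneg_left
      (Real.rpow_le_rpow_of_nonpos (one_sub_normSq_pos hw) hY (by linarith)) hG
  have k0 := key (α - 1) (by linarith)
  have k1 := key α (by linarith)
  have k2 := key (α + 1) (by linarith)
  rw [deriv_sub_dilation hr0 hr1 hf hw, deriv_deriv_sub_dilation hr0 hr1 hf hw]
  have m1 := norm_sub_le (deriv f w) (r * deriv f (r * w))
  have m2 := norm_sub_le (deriv (deriv f) w) ((r : ℂ) ^ 2 * deriv (deriv f) (r * w))
  have n1 : ‖(r : ℂ) * deriv f (r * w)‖ ≤ ‖deriv f (r * w)‖ := by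
    rw [norm_mul, norm_real, Real.norm_of_nonneg hr0]
    exact mul_le_of_le_one_left (norm_nonneg _) hr1
  have n2 : ‖(r : ℂ) ^ 2 * deriv (deriv f) (r * w)‖ ≤ ‖deriv (deriv f) (r * w)‖ := by
    rw [norm_mul, norm_pow, norm_real, Real.norm_of_nonneg hr0]
    exact mul_le_of_le_one_left (norm_nonneg _) (pow_le_one₀ hr0 hr1)
  refine ⟨(norm_sub_le _ _).trans ?_, ?_, ?_⟩ <;> linarith

end Dilation

lemma exists_finite_net_dilation {α r ε : ℝ} (hα : 1 < α) (hr0 : 0 ≤ r) (hr1 : r < 1)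
    (hε : 0 < ε) : ∃ T : Finset (ℂ → ℂ), (∀ g ∈ T, MemBloch α g) ∧
      ∀ f, MemBloch α f → blochNorm α f ≤ 1 →
        ∃ g ∈ T, blochNorm α (fun z => f (r * z) - g (r * z)) ≤ ε := by
  classical
  obtain ⟨M, hM, hbd⟩ := exists_uniform_bound hα hr0 hr1
  obtain ⟨N, hNs, hNf, hNc⟩ := (isCompact_closedBall (0 : ℂ) r).finite_cover_balls
    (e := ε / (8 * M)) (by positivity)
  have := hNf.fintype
  let v : (ℂ → ℂ) → ℂ × (N → ℂ) := fun f => (f 0, fun i => deriv f i)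
  have hS : TotallyBounded (v '' {f | MemBloch α f ∧ blochNorm α f ≤ 1}) := by
    refine (isCompact_closedBall (0 : ℂ × (N → ℂ)) M).totallyBounded.subset ?_
    rintro _ ⟨f, ⟨hf, hf1⟩, rfl⟩
    rw [mem_closedBall_zero_iff]
    refine max_le (hbd f hf hf1 0 (by simpa using hr0)).1 ((pi_norm_le_iff_of_nonneg hM.le).2 ?_)
    exact fun i => (hbd f hf hf1 i (mem_closedBall_zero_iff.1 (hNs i.2))).2.1
  obtain ⟨t, hts, htf, htc⟩ := Metric.finite_approx_of_totallyBounded hS (ε / 4) (by positivity)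
  have hpre : ∀ y ∈ t, ∃ f, (MemBloch α f ∧ blochNorm α f ≤ 1) ∧ v f = y := fun y hy => hts hy
  choose! F hF hvF using hpre
  refine ⟨htf.toFinset.image F, ?_, fun f hf hf1 => ?_⟩
  · intro g hg
    obtain ⟨y, hy, rfl⟩ := Finset.mem_image.1 hg
    exact (hF y (htf.mem_toFinset.1 hy)).1
  obtain ⟨y, hy, hfy⟩ := Set.mem_iUnion₂.1 (htc ⟨f, ⟨hf, hf1⟩, rfl⟩)
  refine ⟨F y, Finset.mem_image_of_mem F (htf.mem_toFinset.2 hy), ?_⟩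
  obtain ⟨hg, hg1⟩ := hF y hy
  rw [← hvF y hy] at hfy
  set g := F y
  rw [Metric.mem_ball, Prod.dist_eq, max_lt_iff, dist_pi_lt_iff (by positivity)] at hfy
  obtain ⟨h0, hN⟩ := hfy
  have hlip : ∀ k, MemBloch α k → blochNorm α k ≤ 1 → ∀ x w : ℂ, ‖x‖ ≤ r → ‖w‖ ≤ r →
      ‖deriv k w - deriv k x‖ ≤ M * ‖w - x‖ := fun k hk hk1 x w hx hw =>
    Convex.norm_image_sub_le_of_norm_deriv_le (s := Metric.closedBall (0 : ℂ) r)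
      (fun z hz => differentiableAt_of_disk (hk.1.deriv isOpen_unitDisk)
        (mem_unitDisk.2 ((mem_closedBall_zero_iff.1 hz).trans_lt hr1)))
      (fun z hz => (hbd k hk hk1 z (mem_closedBall_zero_iff.1 hz)).2.2.1) (convex_closedBall 0 r)
      (mem_closedBall_zero_iff.2 hx) (mem_closedBall_zero_iff.2 hw)
  have hclose : ∀ w : ℂ, ‖w‖ ≤ r → ‖deriv f w - deriv g w‖ ≤ ε / 2 := by
    intro w hw
    obtain ⟨x, hx, hwx⟩ := Set.mem_iUnion₂.1 (hNc (mem_closedBall_zero_iff.2 hw))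
    have hxr := mem_closedBall_zero_iff.1 (hNs hx)
    rw [mem_ball_iff_norm] at hwx
    have l1 := hlip f hf hf1 x w hxr hw
    have l2 := hlip g hg hg1 x w hxr hw
    have l3 : ‖deriv f x - deriv g x‖ < ε / 4 := by
      simpa [v, dist_eq_norm] using hN ⟨x, hx⟩
    have l4 : M * ‖w - x‖ ≤ ε / 8 := by
      calc M * ‖w - x‖ ≤ M * (ε / (8 * M)) := by gcongr
        _ = ε / 8 := by field_simp
    have e : deriv f w - deriv g w
        = (deriv f w - deriv f x) + (deriv f x - deriv g x) - (deriv g w - deriv g x) := by ring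
    rw [e]
    have a1 := norm_sub_le ((deriv f w - deriv f x) + (deriv f x - deriv g x))
      (deriv g w - deriv g x)
    have a2 := norm_add_le (deriv f w - deriv f x) (deriv f x - deriv g x)
    linarith
  have hw : wnorm α (deriv fun z => f (r * z) - g (r * z)) ≤ ε / 2 := by
    refine wnorm_le (by positivity) fun z hz => ?_
    have hz1 := (mem_unitDisk.1 hz).le
    rw [deriv_fun_sub (differentiableAt_of_disk (differentiableOn_dilation hr0 hr1.le hf.1) hz)
      (differentiableAt_of_disk (differentiableOn_dilation hr0 hr1.le hg.1) hz),
      deriv_dilation, deriv_dilation, ← mul_sub, norm_mul, norm_real, Real.norm_of_nonneg hr0]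
    have hrz : ‖(r : ℂ) * z‖ ≤ r := by
      rw [norm_mul, norm_real, Real.norm_of_nonneg hr0]
      exact mul_le_of_le_one_right hr0 hz1
    have h1 : (1 - ‖z‖ ^ 2) ^ α ≤ 1 :=
      Real.rpow_le_one (one_sub_normSq_pos hz).le (one_sub_normSq_le_one z) (by linarith)
    calc _ ≤ 1 * (1 * (ε / 2)) :=
          mul_le_mul h1 (mul_le_mul hr1.le (hclose _ hrz) (norm_nonneg _) zero_le_one)
            (by positivity) zero_le_one
      _ = ε / 2 := by ring
  have h0' : ‖f 0 - g 0‖ < ε / 4 := by simpa [v, dist_eq_norm] using h0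
  simp only [blochNorm, mul_zero]
  linarith

section EssentialNorm

variable {α β : ℝ} {u φ : ℂ → ℂ}

lemma isCompactOp_wcomp_dilation (hα : 1 < α) (hb : BoundedBlochToZygmund α β u φ) {r : ℝ}
    (hr0 : 0 ≤ r) (hr1 : r < 1) :
    IsCompactOpToZygmund α β (MemBloch α) (fun f => wcomp u φ fun z => f (r * z)) := by
  classical
  obtain ⟨C, hC, hbd⟩ := hb.2
  refine ⟨fun f g _ _ a b => ?_, fun f hf => hb.1 _ (hf.dilation hα hr0 hr1.le),
    ⟨C, fun f hf => (hbd _ (hf.dilation hα hr0 hr1.le)).trans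
      (mul_le_mul_of_nonneg_left (hf.blochNorm_dilation_le hα hr0 hr1.le) hC.le)⟩,
    fun ε hε => ?_⟩
  · ext z
    simp only [wcomp]
    ring
  · obtain ⟨T, hT, hnet⟩ := exists_finite_net_dilation hα hr0 hr1 (div_pos hε hC)
    refine ⟨T.image fun g => wcomp u φ fun z => g (r * z), ?_, fun f hf hf1 => ?_⟩
    · intro k hk
      obtain ⟨g, hg, rfl⟩ := Finset.mem_image.1 hk
      exact hb.1 _ ((hT g hg).dilation hα hr0 hr1.le)
    · obtain ⟨g, hg, hfg⟩ := hnet f hf hf1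
      refine ⟨_, Finset.mem_image_of_mem _ hg, ?_⟩
      have h1 := hbd _ ((hf.dilation hα hr0 hr1.le).sub ((hT g hg).dilation hα hr0 hr1.le))
      have h2 : (fun z => wcomp u φ (fun z => f (r * z)) z - wcomp u φ (fun z => g (r * z)) z)
          = wcomp u φ fun z => f (r * z) - g (r * z) := by
        ext z
        simp only [wcomp]
        ring
      rw [h2]
      calc _ ≤ C * (ε / C) := h1.trans (mul_le_mul_of_nonneg_left hfg hC.le)
        _ = ε := by field_simp

lemma essNormZ_le {K : (ℂ → ℂ) → ℂ → ℂ} (hK : IsCompactOpToZygmund α β (MemBloch α) K) {B : ℝ}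
    (hB : 0 ≤ B) (h : ∀ f, MemBloch α f → blochNorm α f ≤ 1 →
      zygNorm β (fun z => wcomp u φ f z - K f z) ≤ B) : essNormZ α β (MemBloch α) u φ ≤ B := by
  have hbdd : BddBelow {r | ∃ K, IsCompactOpToZygmund α β (MemBloch α) K ∧
      r = sSup {s | ∃ f, MemBloch α f ∧ blochNorm α f ≤ 1 ∧
        s = zygNorm β (fun z => wcomp u φ f z - K f z)}} := by
    refine ⟨0, ?_⟩
    rintro _ ⟨K', -, rfl⟩
    refine Real.sSup_nonneg ?_
    rintro _ ⟨f, -, -, rfl⟩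
    exact zygNorm_nonneg _ _
  refine (csInf_le hbdd ⟨K, hK, rfl⟩).trans (Real.sSup_le ?_ hB)
  rintro _ ⟨f, hf, hf1, rfl⟩
  exact h f hf hf1

lemma max_phiLimsup_le_essNormZ (hα : 1 < α) (hu : DifferentiableOn ℂ u unitDisk)
    (hφ : DifferentiableOn ℂ φ unitDisk) (hm : Set.MapsTo φ unitDisk unitDisk)
    (hb : BoundedBlochToZygmund α β u φ) :
    (lowerConst α)⁻¹ * max (phiLimsup φ (quotU α β u φ)) (max (phiLimsup φ (quotV α β u φ))
      (phiLimsup φ (quotW α β u φ))) ≤ essNormZ α β (MemBloch α) u φ := by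
  refine le_csInf ⟨_, _, isCompactOp_wcomp_dilation hα hb le_rfl zero_lt_one, rfl⟩ ?_
  rintro _ ⟨K, hK, rfl⟩
  rw [inv_mul_le_iff₀ (lowerConst_pos hα)]
  exact phiLimsup_quot_le hα hu hφ hm hb hK

lemma weight_mul_norm_combination_le {X : ℝ} (hX : 0 ≤ X) (U V W p q t : ℂ) :
    X * ‖U * p + V * q + W * t‖ ≤ X * ‖U‖ * ‖p‖ + X * ‖V‖ * ‖q‖ + X * ‖W‖ * ‖t‖ := by
  have h1 := norm_add₃_le (a := U * p) (b := V * q) (c := W * t)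
  simp only [norm_mul] at h1
  have := mul_le_mul_of_nonneg_left h1 hX
  linarith

lemma essNormZ_le_max_phiLimsup (hα : 1 < α) {G : ℝ} (hG : 1 ≤ G)
    (hgr : ∀ f, MemBloch α f → blochNorm α f ≤ 1 → ∀ w ∈ unitDisk,
      ‖f w‖ ≤ G * (1 - ‖w‖ ^ 2) ^ (-(α - 1)) ∧ ‖deriv f w‖ ≤ G * (1 - ‖w‖ ^ 2) ^ (-α) ∧
      ‖deriv (deriv f) w‖ ≤ G * (1 - ‖w‖ ^ 2) ^ (-(α + 1)))
    (hu : DifferentiableOn ℂ u unitDisk)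
    (hφ : DifferentiableOn ℂ φ unitDisk) (hm : Set.MapsTo φ unitDisk unitDisk)
    (hb : BoundedBlochToZygmund α β u φ) :
    essNormZ α β (MemBloch α) u φ ≤ 6 * G * max (phiLimsup φ (quotU α β u φ))
      (max (phiLimsup φ (quotV α β u φ)) (phiLimsup φ (quotW α β u φ))) := by
  obtain ⟨L, hL, hcoef⟩ := exists_coeff_bound hα hu hφ hm hb
  obtain ⟨B, hB⟩ := exists_quot_bound hα hu hφ hm hb
  set m := max (phiLimsup φ (quotU α β u φ))
      (max (phiLimsup φ (quotV α β u φ)) (phiLimsup φ (quotW α β u φ))) with hmdef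
  have hm0 : 0 ≤ m := (phiLimsup_nonneg fun z hz => quotU_nonneg hm hz).trans (le_max_left _ _)
  refine le_of_forall_pos_le_add fun ε' hε' => ?_
  set ε := ε' / (6 * G + 1) with hε
  have hε0 : 0 < ε := by positivity
  obtain ⟨s1, hs1, H1⟩ := exists_le_phiLimsup_add (fun z hz => (hB z hz).1) hε0
  obtain ⟨s2, hs2, H2⟩ := exists_le_phiLimsup_add (fun z hz => (hB z hz).2.1) hε0
  obtain ⟨s3, hs3, H3⟩ := exists_le_phiLimsup_add (fun z hz => (hB z hz).2.2) hε0
  set s := max ‖φ 0‖ (max s1 (max s2 s3)) with hs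
  have hs_lt : s < 1 := by
    rw [hs]
    simp only [max_lt_iff]
    exact ⟨mem_unitDisk.1 (hm zero_mem_unitDisk), hs1, hs2, hs3⟩
  have hs0 : 0 ≤ s := (norm_nonneg _).trans (le_max_left _ _)
  have hφ0 : ‖φ 0‖ ≤ s := le_max_left _ _
  obtain ⟨M, hM, hbd⟩ := exists_uniform_bound hα hs0 hs_lt
  set J := 3 * L + (‖u 0‖ + ‖deriv u 0‖ + ‖u 0‖ * ‖deriv φ 0‖) with hJ
  have hJ0 : 0 ≤ J := by positivity
  set η := ε / (J + 1) with hη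
  have hη0 : 0 < η := by positivity
  have hJη : J * η ≤ ε := by
    rw [hη, mul_div_assoc', div_le_iff₀ (by positivity)]
    nlinarith
  set r := 1 - min 1 (η / (3 * M)) with hr
  have hr0 : 0 ≤ r := by
    have := min_le_left 1 (η / (3 * M))
    linarith
  have hr1 : r < 1 := by
    have : 0 < min 1 (η / (3 * M)) := lt_min one_pos (by positivity)
    linarith
  have hrη : 3 * M * (1 - r) ≤ η := by
    calc 3 * M * (1 - r) ≤ 3 * M * (η / (3 * M)) := by
          rw [hr, sub_sub_cancel]
          gcongr
          exact min_le_right _ _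
      _ = η := by field_simp
  have hfin : 6 * G * (m + ε) + ε = 6 * G * m + ε' := by
    have : ε * (6 * G + 1) = ε' := by rw [hε]; field_simp
    linarith
  rw [← hfin]
  refine essNormZ_le (isCompactOp_wcomp_dilation hα hb hr0 hr1) (by positivity) fun f hf hf1 => ?_
  have hsub : (fun z => wcomp u φ f z - wcomp u φ (fun z => f (r * z)) z)
      = wcomp u φ fun z => f z - f (r * z) := by
    ext z
    simp only [wcomp]
    ring
  rw [hsub]
  set h : ℂ → ℂ := fun z => f z - f (r * z) with hh
  have hhB : MemBloch α h := hf.sub (hf.dilation hα hr0 hr1.le)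
  have near : ∀ w : ℂ, ‖w‖ ≤ s → ‖h w‖ ≤ η ∧ ‖deriv h w‖ ≤ η ∧ ‖deriv (deriv h) w‖ ≤ η := by
    intro w hw
    obtain ⟨n0, n1, n2⟩ := sub_dilation_near hr0 hr1.le hs_lt hf.1 (hbd f hf hf1) hw
    exact ⟨n0.trans hrη, n1.trans hrη, n2.trans hrη⟩
  have far := fun w hw => sub_dilation_far hr0 hr1.le hα (by linarith) hf.1 (hgr f hf hf1)
    (w := w) hw
  obtain ⟨z0, z1, -⟩ := near _ hφ0
  have hval : ‖wcomp u φ h 0‖ ≤ ‖u 0‖ * η := by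
    rw [wcomp, norm_mul]
    gcongr
  have hder : ‖deriv (wcomp u φ h) 0‖ ≤ ‖deriv u 0‖ * η + ‖u 0‖ * (η * ‖deriv φ 0‖) := by
    rw [deriv_wcomp hu hφ hm hhB.1 zero_mem_unitDisk]
    refine (norm_add_le _ _).trans ?_
    rw [norm_mul, norm_mul, norm_mul]
    gcongr
  have hw : wnorm β (deriv (deriv (wcomp u φ h))) ≤ 6 * G * (m + ε) + 3 * L * η := by
    refine wnorm_le (by positivity) fun z hz => ?_
    rw [deriv_deriv_wcomp hu hφ hm hhB.1 hz]
    have hX := weight_nonneg β hz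
    refine (weight_mul_norm_combination_le hX _ _ _ _ _ _).trans ?_
    rw [norm_mul (u z), norm_pow]
    rcases le_or_gt ‖φ z‖ s with hzs | hzs
    · obtain ⟨c1, c2, c3⟩ := hcoef z hz
      obtain ⟨n0, n1, n2⟩ := near _ hzs
      have t1 := mul_le_mul c1 n0 (norm_nonneg _) hL
      have t2 := mul_le_mul c2 n1 (norm_nonneg _) hL
      have t3 := mul_le_mul c3 n2 (norm_nonneg _) hL
      have t4 : 0 ≤ 6 * G * (m + ε) := by positivity
      linarith
    · rw [hs] at hzs
      simp only [max_lt_iff] at hzs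
      obtain ⟨f0, f1, f2⟩ := far _ (hm hz)
      have q1 : quotU α β u φ z ≤ m + ε :=
        (H1 z hz hzs.2.1).trans (by gcongr; exact le_max_left _ _)
      have q2 : quotV α β u φ z ≤ m + ε :=
        (H2 z hz hzs.2.2.1).trans
          (by gcongr; exact (le_max_left _ _).trans (le_max_right _ _))
      have q3 : quotW α β u φ z ≤ m + ε :=
        (H3 z hz hzs.2.2.2).trans
          (by gcongr; exact (le_max_right _ _).trans (le_max_right _ _))
      have hY := one_sub_normSq_pos (hm hz)
      have conv : ∀ E n γ : ℝ, 0 ≤ E → n ≤ 2 * G * (1 - ‖φ z‖ ^ 2) ^ (-γ) →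
          E / (1 - ‖φ z‖ ^ 2) ^ γ ≤ m + ε → E * n ≤ 2 * G * (m + ε) := by
        intro E n γ hE hn hq
        calc E * n ≤ E * (2 * G * (1 - ‖φ z‖ ^ 2) ^ (-γ)) := by gcongr
          _ = 2 * G * (E / (1 - ‖φ z‖ ^ 2) ^ γ) := by rw [Real.rpow_neg hY.le]; ring
          _ ≤ _ := by gcongr
      have t1 := conv _ _ _ (mul_nonneg hX (norm_nonneg _)) f0 q1
      have t2 := conv _ _ _ (mul_nonneg hX (norm_nonneg _)) f1 q2
      have t3 := conv _ _ _ (mul_nonneg hX (by positivity)) f2 q3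
      have t4 : 0 ≤ 3 * L * η := by positivity
      linarith
  have hJe : J * η = 3 * L * η + (‖u 0‖ * η + (‖deriv u 0‖ * η + ‖u 0‖ * (η * ‖deriv φ 0‖))) := by
    rw [hJ]; ring
  unfold zygNorm
  linarith

end EssentialNorm

/-- **Theorem 4.4** (pointwise form). For `α > 1` and `uC_φ : B^α → Z_β` bounded,
`‖uC_φ‖_e` is comparable with the maximum of the three `limsup_{|φ(z)|→1}` quantities,
with constants depending only on `α, β`. -/
theorem essNorm_Bloch_to_Zygmund_of_one_lt'
    (α β : ℝ) (hα : 1 < α) (hβ : 0 < β) :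
    ∃ c C : ℝ, 0 < c ∧ 0 < C ∧
      ∀ u φ : ℂ → ℂ, DifferentiableOn ℂ u unitDisk → DifferentiableOn ℂ φ unitDisk →
        Set.MapsTo φ unitDisk unitDisk → BoundedBlochToZygmund α β u φ →
        c * max
              (phiLimsup φ (fun z => (1 - ‖z‖ ^ 2) ^ β * ‖deriv (deriv u) z‖ / (1 - ‖φ z‖ ^ 2) ^ (α - 1)))
              (max
                (phiLimsup φ (fun z => (1 - ‖z‖ ^ 2) ^ β * ‖2 * deriv u z * deriv φ z + u z * deriv (deriv φ) z‖ / (1 - ‖φ z‖ ^ 2) ^ α))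
                (phiLimsup φ (fun z => (1 - ‖z‖ ^ 2) ^ β * (‖u z‖ * ‖deriv φ z‖ ^ 2) / (1 - ‖φ z‖ ^ 2) ^ (α + 1))))
            ≤ essNormZ α β (MemBloch α) u φ ∧
          essNormZ α β (MemBloch α) u φ
            ≤ C * max
                (phiLimsup φ (fun z => (1 - ‖z‖ ^ 2) ^ β * ‖deriv (deriv u) z‖ / (1 - ‖φ z‖ ^ 2) ^ (α - 1)))
                (max
                  (phiLimsup φ (fun z => (1 - ‖z‖ ^ 2) ^ β * ‖2 * deriv u z * deriv φ z + u z * deriv (deriv φ) z‖ / (1 - ‖φ z‖ ^ 2) ^ α))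
                  (phiLimsup φ (fun z => (1 - ‖z‖ ^ 2) ^ β * (‖u z‖ * ‖deriv φ z‖ ^ 2) / (1 - ‖φ z‖ ^ 2) ^ (α + 1)))) := by
  obtain ⟨G, hG, hgr⟩ := exists_growth_const hα
  refine ⟨(lowerConst α)⁻¹, 6 * G, inv_pos.2 (lowerConst_pos hα), by positivity,
    fun u φ hu hφ hm hb => ⟨max_phiLimsup_le_essNormZ hα hu hφ hm hb, ?_⟩⟩
  exact essNormZ_le_max_phiLimsup hα hG
    (fun f hf hf1 w hw => ⟨(hgr f hf hf1 w hw).1, (hgr f hf hf1 w hw).2.1,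
      (hgr f hf hf1 w hw).2.2.1⟩) hu hφ hm hb

end
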